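/- arXiv:1203.4581 — 2 statements merged into one kernel-verified Lean document; each statement's English description precedes it below -/
import Mathlib

section
/- Let L be a non-contractible compact metric ANR and X, Y non-empty compact (Hausdorff) spaces. Then L-Ind Z(X,Y) ≤ max{ L-Ind X + 1, L-Ind Y }. -/
open Set Topology Cardinal

noncomputable section

attribute [local instance] Classical.propDecidable

/-- Values of dimension functions: `⊥ : WithBot Ordinal.{0}` encodes `−1`,
ordinals are the usual values, and `⊤` encodes `∞`. -/
abbrev Dim : Type 1 := WithTop (WithBot Ordinal.{0})

/-- An ordinal viewed as a dimension value. -/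
def Dim.ofOrdinal (a : Ordinal.{0}) : Dim := ((a : WithBot Ordinal.{0}) : Dim)

/-- The dimension value `−1`. -/
def Dim.minusOne : Dim := ((⊥ : WithBot Ordinal.{0}) : Dim)

/-- An integer `m ≥ −1` viewed as a dimension value. -/
def Dim.ofInt (m : ℤ) : Dim := if 0 ≤ m then Dim.ofOrdinal m.toNat else Dim.minusOne

/-- `A` is a `K`-tuple for the simplicial complex `K` on the vertex set `Fin m`:
whenever the members indexed by a nonempty `I` have a common point, `I` spans a
simplex of `K`. -/
def IsKTuple {m : ℕ} (K : Finset (Fin m) → Prop) {X : Type} (A : Fin m → Set X) : Prop :=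
  ∀ I : Finset (Fin m), I.Nonempty → (⋂ i ∈ I, A i).Nonempty → K I

/-- `K` is an abstract (finite) simplicial complex with vertex set `Fin m`:
it is closed under passing to nonempty subsets, and contains every vertex. -/
def IsComplex {m : ℕ} (K : Finset (Fin m) → Prop) : Prop :=
  (∀ s t : Finset (Fin m), s ⊆ t → s.Nonempty → K t → K s) ∧ ∀ i, K {i}

/-- The boundary complex `∂Δ^k` of the `k`-simplex: all proper subsets of the
`k+1` vertices span simplices. -/
def bComplex (k : ℕ) : Finset (Fin (k + 1)) → Prop := fun s => s ≠ Finset.univ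

/-- `U` is an (open) `K`-neighbourhood of the tuple `F`. -/
def KNbhd {m : ℕ} (K : Finset (Fin m) → Prop) {X : Type} [TopologicalSpace X]
    (F U : Fin m → Set X) : Prop :=
  (∀ i, IsOpen (U i)) ∧ IsKTuple K U ∧ ∀ i, F i ⊆ U i

/-- Auxiliary form of `K-Ind X ≤ α`, defined by transfinite recursion on `α`:
every closed `K`-tuple has a `K`-neighbourhood whose corresponding `K`-partition
is either empty (dimension `−1`) or has `K-Ind < α`. -/
def KIndLeAux {m : ℕ} (K : Finset (Fin m) → Prop) :
    Ordinal.{0} → ∀ X : Type, TopologicalSpace X → Prop :=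
  (wellFounded_lt (α := Ordinal.{0})).fix fun α rec X tX =>
    letI := tX
    ∀ F : Fin m → Set X, (∀ i, IsClosed (F i)) → IsKTuple K F →
      ∃ U : Fin m → Set X, (∀ i, IsOpen (U i)) ∧ IsKTuple K U ∧ (∀ i, F i ⊆ U i) ∧
        ((⋃ i, U i)ᶜ = (∅ : Set X) ∨
          ∃ β : Set.Iio α, rec β.1 β.2 (↥((⋃ i, U i)ᶜ)) inferInstance)

/-- `K-Ind X ≤ α` (for an ordinal `α ≥ 0`). -/
def KIndLE {m : ℕ} (K : Finset (Fin m) → Prop) (X : Type) [tX : TopologicalSpace X]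
    (α : Ordinal.{0}) : Prop :=
  KIndLeAux K α X tX

/-- Fedorchuk's inductive dimension `K-Ind` modulo a simplicial complex `K`;
`−1` for the empty space, the least `α` with `K-Ind X ≤ α` otherwise, `∞` if none. -/
def KInd {m : ℕ} (K : Finset (Fin m) → Prop) (X : Type) [TopologicalSpace X] : Dim :=
  if IsEmpty X then Dim.minusOne
  else if ∃ α, KIndLE K X α then Dim.ofOrdinal (sInf {α | KIndLE K X α}) else ⊤

/-- The set of `K`-obstruction points of an open `K`-tuple `U`: points covered
by no `K`-neighbourhood of `U`. -/
def KObs {m : ℕ} (K : Finset (Fin m) → Prop) {X : Type} [TopologicalSpace X]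
    (U : Fin m → Set X) : Set X :=
  {x | ¬ ∃ V : Fin m → Set X, KNbhd K U V ∧ x ∈ ⋃ i, V i}

/-- `X` is strongly `α`-dimensional: `K-Ind X` is a positive ordinal `α` and some
closed `K`-tuple admits no `K`-neighbourhood `U` without obstruction points whose
corresponding `K`-partition has `K-Ind < α`. -/
def KStrongly {m : ℕ} (K : Finset (Fin m) → Prop) (X : Type) [TopologicalSpace X] : Prop :=
  (∃ α : Ordinal.{0}, 0 < α ∧ KInd K X = Dim.ofOrdinal α) ∧
  ∃ F : Fin m → Set X, (∀ i, IsClosed (F i)) ∧ IsKTuple K F ∧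
    ∀ U : Fin m → Set X, KNbhd K F U →
      KInd K (↥((⋃ i, U i)ᶜ)) < KInd K X → KObs K U ≠ ∅

/-- The dimensional strength degree `K-str X ∈ {0,1}`. -/
def KStr {m : ℕ} (K : Finset (Fin m) → Prop) (X : Type) [TopologicalSpace X] : ℕ :=
  if KStrongly K X then 1 else 0

/-- `K-dim X ≤ n`: any `n+1` closed `K`-tuples admit `K`-partitions with empty
intersection. -/
def KDimLE {m : ℕ} (K : Finset (Fin m) → Prop) (X : Type) [TopologicalSpace X] (n : ℕ) : Prop :=
  ∀ F : Fin (n + 1) → Fin m → Set X,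
    (∀ j i, IsClosed (F j i)) → (∀ j, IsKTuple K (F j)) →
    ∃ U : Fin (n + 1) → Fin m → Set X, (∀ j, KNbhd K (F j) (U j)) ∧
      (⋂ j, (⋃ i, U j i)ᶜ) = (∅ : Set X)

/-- Fedorchuk's dimension `K-dim` modulo a simplicial complex `K`. -/
def KDim {m : ℕ} (K : Finset (Fin m) → Prop) (X : Type) [TopologicalSpace X] : Dim :=
  if IsEmpty X then Dim.minusOne
  else if ∃ n, KDimLE K X n then Dim.ofOrdinal ((sInf {n | KDimLE K X n} : ℕ) : Ordinal.{0}) else ⊤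

/-- `dim X ≤ n` for the Lebesgue covering dimension: every finite open cover has
an open shrinking of order at most `n+1`. -/
def CovDimLE (X : Type) [TopologicalSpace X] (n : ℕ) : Prop :=
  ∀ (ι : Type), Finite ι → ∀ U : ι → Set X, (∀ i, IsOpen (U i)) → (⋃ i, U i) = Set.univ →
    ∃ V : ι → Set X, (∀ i, IsOpen (V i)) ∧ (∀ i, V i ⊆ U i) ∧ (⋃ i, V i) = Set.univ ∧
      ∀ x : X, ({i | x ∈ V i}).ncard ≤ n + 1

/-- The Lebesgue covering dimension. -/
def covDim (X : Type) [TopologicalSpace X] : Dim :=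
  if IsEmpty X then Dim.minusOne
  else if ∃ n, CovDimLE X n then Dim.ofOrdinal ((sInf {n | CovDimLE X n} : ℕ) : Ordinal.{0}) else ⊤

/-- `Ind X ≤ n` for the large inductive dimension, by recursion on `n`. -/
def IndLE : ℕ → ∀ X : Type, TopologicalSpace X → Prop
  | 0, X, tX =>
    letI := tX
    ∀ F U : Set X, IsClosed F → IsOpen U → F ⊆ U →
      ∃ V : Set X, IsOpen V ∧ F ⊆ V ∧ V ⊆ U ∧ frontier V = ∅
  | n + 1, X, tX =>
    letI := tX
    ∀ F U : Set X, IsClosed F → IsOpen U → F ⊆ U →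
      ∃ V : Set X, IsOpen V ∧ F ⊆ V ∧ V ⊆ U ∧ IndLE n (↥(frontier V)) inferInstance

/-- The large inductive dimension `Ind`. -/
def IndDim (X : Type) [tX : TopologicalSpace X] : Dim :=
  if IsEmpty X then Dim.minusOne
  else if ∃ n, IndLE n X tX then Dim.ofOrdinal ((sInf {n | IndLE n X tX} : ℕ) : Ordinal.{0}) else ⊤

/-- The relation generating the topological join `A ∗ B`: the copy of `B` is
collapsed at parameter `0`, the copy of `A` at parameter `1`. -/
def JoinRel (A B : Type) : (A × B × unitInterval) → (A × B × unitInterval) → Prop :=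
  fun p q => (p.2.2 = 0 ∧ q.2.2 = 0 ∧ p.1 = q.1) ∨ (p.2.2 = 1 ∧ q.2.2 = 1 ∧ p.2.1 = q.2.1)

/-- The topological join `A ∗ B`. -/
abbrev Join (A B : Type) [TopologicalSpace A] [TopologicalSpace B] : Type :=
  Quot (JoinRel A B)

/-- Auxiliary construction of the join of `n+1` copies of `L`, bundled with its
topology. -/
def JoinPowAux (L : Type) (tL : TopologicalSpace L) : ℕ → (T : Type) × TopologicalSpace T
  | 0 => ⟨L, tL⟩
  | n + 1 =>
    let p := JoinPowAux L tL n
    letI := tL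
    letI := p.2
    ⟨Join L p.1, inferInstance⟩

/-- The join `L ∗ ⋯ ∗ L` of `n+1` copies of `L`. -/
def JoinPow (L : Type) [tL : TopologicalSpace L] (n : ℕ) : Type :=
  (JoinPowAux L tL n).1

instance joinPowTopologicalSpace (L : Type) [tL : TopologicalSpace L] (n : ℕ) :
    TopologicalSpace (JoinPow L n) :=
  (JoinPowAux L tL n).2

/-- `L-dim X ≤ n`: every continuous map from a closed subset of `X` to the join
of `n+1` copies of `L` extends continuously over `X`. -/
def LDimLE (L : Type) [TopologicalSpace L] (X : Type) [TopologicalSpace X] (n : ℕ) : Prop :=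
  ∀ F : Set X, IsClosed F → ∀ f : C(F, JoinPow L n),
    ∃ g : C(X, JoinPow L n), ∀ x : F, g x = f x

/-- Fedorchuk's dimension `L-dim` modulo an ANR `L`. -/
def LDim (L : Type) [TopologicalSpace L] (X : Type) [TopologicalSpace X] : Dim :=
  if IsEmpty X then Dim.minusOne
  else if ∃ n, LDimLE L X n then Dim.ofOrdinal ((sInf {n | LDimLE L X n} : ℕ) : Ordinal.{0}) else ⊤

/-- Auxiliary form of `L-Ind X ≤ α`, by transfinite recursion on `α`: every map
to `L` from a closed subset of `X` has an `L`-partition which is either empty or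
has `L-Ind < α`. -/
def LIndLeAux (L : Type) [TopologicalSpace L] :
    Ordinal.{0} → ∀ X : Type, TopologicalSpace X → Prop :=
  (wellFounded_lt (α := Ordinal.{0})).fix fun α rec X tX =>
    letI := tX
    ∀ F : Set X, IsClosed F → ∀ f : C(F, L),
      ∃ U : Set X, IsOpen U ∧ ∃ hFU : F ⊆ U,
        (∃ g : C(U, L), ∀ (x : X) (hx : x ∈ F), g ⟨x, hFU hx⟩ = f ⟨x, hx⟩) ∧
        (Uᶜ = (∅ : Set X) ∨ ∃ β : Set.Iio α, rec β.1 β.2 (↥(Uᶜ)) inferInstance)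

/-- `L-Ind X ≤ α` (for an ordinal `α ≥ 0`). -/
def LIndLE (L : Type) [TopologicalSpace L] (X : Type) [tX : TopologicalSpace X]
    (α : Ordinal.{0}) : Prop :=
  LIndLeAux L α X tX

/-- Fedorchuk's inductive dimension `L-Ind` modulo an ANR `L`. -/
def LInd (L : Type) [TopologicalSpace L] (X : Type) [TopologicalSpace X] : Dim :=
  if IsEmpty X then Dim.minusOne
  else if ∃ α, LIndLE L X α then Dim.ofOrdinal (sInf {α | LIndLE L X α}) else ⊤

/-- `L` is an absolute neighbourhood retract (for metric spaces): `L` is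
metrizable and whenever a closed subset `A` of a metric space is homeomorphic to
`L` via `e`, the map `e` extends continuously over a neighbourhood of `A`. -/
def IsANR (L : Type) [TopologicalSpace L] : Prop :=
  TopologicalSpace.MetrizableSpace L ∧
  ∀ (M : Type) [MetricSpace M], ∀ A : Set M, IsClosed A → ∀ e : A ≃ₜ L,
    ∃ U : Set M, IsOpen U ∧ ∃ hAU : A ⊆ U, ∃ r : C(U, L),
      ∀ (a : M) (ha : a ∈ A), r ⟨a, hAU ha⟩ = e ⟨a, ha⟩

/-- `L-Ind_{b+} X`: the least dimension value `d` such that some open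
neighbourhood of `b` has closure of `L-Ind` at most `d`. -/
def LIndPlus (L : Type) [TopologicalSpace L] {X : Type} [TopologicalSpace X] (b : X) : Dim :=
  sInf {d : Dim | ∃ U : Set X, IsOpen U ∧ b ∈ U ∧ LInd L (↥(closure U)) ≤ d}

/-- The set `K(X) = {b ∈ X : L-Ind_{b+} X = L-Ind X}`. -/
def LKset (L : Type) [TopologicalSpace L] (X : Type) [TopologicalSpace X] : Set X :=
  {b | LIndPlus L b = LInd L X}

/-- The weight of a topological space: the least cardinality of a basis. -/
def tWeight (X : Type) [TopologicalSpace X] : Cardinal :=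
  sInf {c | ∃ B : Set (Set X), TopologicalSpace.IsTopologicalBasis B ∧ #B = c}

/-- The family `𝒮_X` of all subsets of `X` that are finite or homeomorphic to the
one-point compactification `A_{ℵ₀}` of a countably infinite discrete space. -/
def SFam (X : Type) [TopologicalSpace X] : Set (Set X) :=
  {S | S.Finite ∨ Nonempty (↥S ≃ₜ OnePoint ℕ)}

/-- The relation generating the quotient `N` in the `Z(X,Y)` construction:
each set `{μ} × {x} × Y` is collapsed to a point. -/
def ZRel (ι X Y : Type) : (OnePoint ι × X × Y) → (OnePoint ι × X × Y) → Prop :=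
  fun p q => p.1 = OnePoint.infty ∧ q.1 = OnePoint.infty ∧ p.2.1 = q.2.1

/-- The quotient space `N` of `A_𝔪 × X × Y`. -/
abbrev ZQuot (ι X Y : Type) [TopologicalSpace ι] [TopologicalSpace X] [TopologicalSpace Y] :
    Type :=
  Quot (ZRel ι X Y)

/-- The subset `Z(X,Y) = ⋃_{α ∈ A_𝔪} H(α)` of `N`:  `H(μ) = π₁({μ} × X × Y)` and
`H(α) = π₁({α} × φ(α) × Y)` for `α ≠ μ`. -/
def ZSet (ι X Y : Type) [TopologicalSpace ι] [TopologicalSpace X] [TopologicalSpace Y]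
    (φ : ι → Set X) : Set (ZQuot ι X Y) :=
  {z | ∃ p : OnePoint ι × X × Y, Quot.mk (ZRel ι X Y) p = z ∧
        (p.1 = OnePoint.infty ∨ ∃ i : ι, p.1 = (i : OnePoint ι) ∧ p.2.1 ∈ φ i)}

/-- The space `Z(X,Y)` (for the data `ι`, `φ`), with the subspace topology. -/
abbrev ZSpace (ι X Y : Type) [TopologicalSpace ι] [TopologicalSpace X] [TopologicalSpace Y]
    (φ : ι → Set X) : Type :=
  ↥(ZSet ι X Y φ)

/-- The subset `H(μ)` of `Z(X,Y)`. -/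
def ZHmu (ι X Y : Type) [TopologicalSpace ι] [TopologicalSpace X] [TopologicalSpace Y]
    (φ : ι → Set X) : Set (ZSpace ι X Y φ) :=
  {z | ∃ (x : X) (y : Y), (z : ZQuot ι X Y) = Quot.mk (ZRel ι X Y) (OnePoint.infty, x, y)}

/-- The projection `π_X : N → X`, `π₁(α,x,y) ↦ x`. -/
def ZQuotProjX {ι X Y : Type} [TopologicalSpace ι] [TopologicalSpace X] [TopologicalSpace Y] :
    ZQuot ι X Y → X :=
  Quot.lift (fun p => p.2.1) (fun _ _ h => h.2.2)

/-- The projection `π_X : Z(X,Y) → X`. -/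
def ZProjX {ι X Y : Type} [TopologicalSpace ι] [TopologicalSpace X] [TopologicalSpace Y]
    (φ : ι → Set X) : ZSpace ι X Y φ → X :=
  fun z => ZQuotProjX (z : ZQuot ι X Y)

/-- The cardinality requirements on the index set `ι` (of cardinality `𝔪`) in the
`Z(X,Y)` construction: `𝔪 ≥ max {ℵ₀, (wX)⁺, (wY)⁺, card 𝒮_X}`. -/
def ZCardOK (X Y ι : Type) [TopologicalSpace X] [TopologicalSpace Y] : Prop :=
  ℵ₀ ≤ #ι ∧ tWeight X < #ι ∧ tWeight Y < #ι ∧ #(SFam X) ≤ #ι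

/-- The requirements on `φ : A_𝔪 \ {μ} → 𝒮_X`: it takes values in `𝒮_X` and every
fibre has cardinality `𝔪`. -/
def ZPhiOK {X ι : Type} [TopologicalSpace X] (φ : ι → Set X) : Prop :=
  (∀ i, φ i ∈ SFam X) ∧ ∀ S ∈ SFam X, #(↥(φ ⁻¹' {S})) = #ι


theorem LIndLE_iff_sub (L : Type) [TopologicalSpace L] (X : Type) [TopologicalSpace X]
    (α : Ordinal.{0}) : LIndLE L X α ↔
    ∀ F : Set X, IsClosed F → ∀ f : C(F, L),
      ∃ U : Set X, IsOpen U ∧ ∃ hFU : F ⊆ U,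
        (∃ g : C(U, L), ∀ (x : X) (hx : x ∈ F), g ⟨x, hFU hx⟩ = f ⟨x, hx⟩) ∧
        (Uᶜ = (∅ : Set X) ∨ ∃ β : Set.Iio α, LIndLE L (↥(Uᶜ)) β.1) := by
  unfold LIndLE
  conv_lhs => unfold LIndLeAux
  rw [WellFounded.fix_eq]
  rfl

/-- Empty or of `L-Ind` strictly below `α`. -/
def LIndLT (L : Type) [TopologicalSpace L] (X : Type) [TopologicalSpace X]
    (α : Ordinal.{0}) : Prop := IsEmpty X ∨ ∃ β < α, LIndLE L X β

theorem nonempty_of_LIndLE (L : Type) [TopologicalSpace L] (α : Ordinal.{0}) :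
    ∀ (X : Type) [TopologicalSpace X] [Nonempty X], LIndLE L X α → Nonempty L := by
  induction α using WellFoundedLT.induction with
  | ind α ih =>
    intro X _ _ h
    rw [LIndLE_iff_sub] at h
    obtain ⟨U, hU, hFU, ⟨g, hg⟩, h⟩ := h ∅ isClosed_empty
      ⟨fun x => x.2.elim, continuous_of_const fun x => x.2.elim⟩
    rcases U.eq_empty_or_nonempty with rfl | ⟨x, hx⟩
    · rcases h with h | ⟨β, h⟩
      · simp at h
      · have : Nonempty (↥((∅ : Set X)ᶜ)) := ⟨⟨Classical.arbitrary X, by simp⟩⟩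
        exact ih β.1 β.2 _ h
    · exact ⟨g ⟨x, hx⟩⟩

theorem LIndLE_iff (L : Type) [TopologicalSpace L] [Nonempty L] (X : Type) [TopologicalSpace X]
    (α : Ordinal.{0}) : LIndLE L X α ↔
    ∀ F : Set X, IsClosed F → ∀ f : X → L, ContinuousOn f F →
      ∃ U : Set X, IsOpen U ∧ F ⊆ U ∧ ∃ g : X → L, ContinuousOn g U ∧ EqOn g f F ∧
        LIndLT L (↥(Uᶜ)) α := by
  rw [LIndLE_iff_sub]
  constructor
  · intro h F hF f hf
    obtain ⟨U, hU, hFU, ⟨g, hg⟩, h⟩ := h F hF ⟨F.domRestrict f, continuousOn_iff_continuous_domRestrict.1 hf⟩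
    refine ⟨U, hU, hFU, fun x => if hx : x ∈ U then g ⟨x, hx⟩ else Classical.arbitrary L, ?_, ?_, ?_⟩
    · rw [continuousOn_iff_continuous_domRestrict]
      convert g.continuous using 1
      ext x
      simp
    · intro x hx
      simp only [hFU hx, dif_pos]
      exact hg x hx
    · rcases h with h | ⟨β, h⟩
      · left; rw [h]; infer_instance
      · right; exact ⟨β.1, β.2, h⟩
  · intro h F hF f
    obtain ⟨U, hU, hFU, g, hg, hgf, h⟩ := h F hF
      (fun x => if hx : x ∈ F then f ⟨x, hx⟩ else Classical.arbitrary L) (by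
        rw [continuousOn_iff_continuous_domRestrict]
        convert f.continuous using 1
        ext x
        simp)
    refine ⟨U, hU, hFU, ⟨⟨U.domRestrict g, continuousOn_iff_continuous_domRestrict.1 hg⟩, ?_⟩, ?_⟩
    · intro x hx
      have := hgf hx
      simp only [hx, dif_pos] at this
      exact this
    · rcases h with h | ⟨β, hβ, h⟩
      · left; exact Set.isEmpty_coe_sort.1 h
      · right; exact ⟨⟨β, hβ⟩, h⟩

theorem LIndLT.mono {L : Type} [TopologicalSpace L] {X : Type} [TopologicalSpace X]
    {α β : Ordinal.{0}} (hαβ : α ≤ β) (h : LIndLT L X α) : LIndLT L X β := by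
  rcases h with h | ⟨γ, hγ, h⟩
  · exact Or.inl h
  · exact Or.inr ⟨γ, hγ.trans_le hαβ, h⟩

theorem LIndLE.mono {L : Type} [TopologicalSpace L] [Nonempty L] {X : Type} [TopologicalSpace X]
    {α β : Ordinal.{0}} (hαβ : α ≤ β) (h : LIndLE L X α) : LIndLE L X β := by
  rw [LIndLE_iff] at *
  intro F hF f hf
  obtain ⟨U, hU, hFU, g, hg, hgf, h⟩ := h F hF f hf
  exact ⟨U, hU, hFU, g, hg, hgf, h.mono hαβ⟩

theorem LIndLE_of_isEmpty {L : Type} [TopologicalSpace L] [Nonempty L] {X : Type}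
    [TopologicalSpace X] [IsEmpty X] (α : Ordinal.{0}) : LIndLE L X α := by
  rw [LIndLE_iff]
  intro F hF f hf
  exact ⟨univ, isOpen_univ, subset_univ _, f, continuous_of_const (fun x => isEmptyElim x)
    |>.continuousOn, fun _ _ => rfl, Or.inl ⟨fun x => isEmptyElim x.1⟩⟩

theorem LIndLE.of_isClosedEmbedding {L : Type} [TopologicalSpace L] [Nonempty L]
    (α : Ordinal.{0}) : ∀ {A X : Type} [TopologicalSpace A] [TopologicalSpace X] (e : A → X),
    IsClosedEmbedding e → LIndLE L X α → LIndLE L A α := by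
  induction α using WellFoundedLT.induction with
  | ind α ih =>
    intro A X _ _ e he h
    rw [LIndLE_iff] at *
    intro F hF f hf
    obtain ⟨U, hU, hFU, g, hg, hgf, h⟩ := h (e '' F) (he.isClosedMap F hF)
      (Function.extend e f fun _ => Classical.arbitrary L) (by
        rintro _ ⟨x, hx, rfl⟩
        unfold ContinuousWithinAt
        rw [← he.isInducing.map_nhdsWithin_eq, Filter.tendsto_map'_iff,
          he.injective.extend_apply]
        have hfe : (Function.extend e f fun _ => Classical.arbitrary L) ∘ e = f := by
          ext y
          simp [he.injective.extend_apply]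
        rw [hfe]
        exact hf x hx)
    refine ⟨e ⁻¹' U, hU.preimage he.continuous, fun x hx => hFU (mem_image_of_mem e hx), g ∘ e,
      hg.comp he.continuous.continuousOn fun x hx => hx, ?_, ?_⟩
    · intro x hx
      have := hgf (mem_image_of_mem e hx)
      rwa [he.injective.extend_apply] at this
    · rcases h with h | ⟨β, hβ, h⟩
      · left; exact ⟨fun x => h.elim ⟨e x.1, x.2⟩⟩
      · right
        refine ⟨β, hβ, ih β hβ (fun x : ↥((e ⁻¹' U)ᶜ) => (⟨e x.1, x.2⟩ : ↥(Uᶜ))) ?_ h⟩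
        exact he.restrictPreimage Uᶜ

theorem LIndLT.of_isClosedEmbedding {L : Type} [TopologicalSpace L] [Nonempty L]
    {α : Ordinal.{0}} {A X : Type} [TopologicalSpace A] [TopologicalSpace X] (e : A → X)
    (he : IsClosedEmbedding e) (h : LIndLT L X α) : LIndLT L A α := by
  rcases h with h | ⟨β, hβ, h⟩
  · exact Or.inl ⟨fun a => h.elim (e a)⟩
  · exact Or.inr ⟨β, hβ, h.of_isClosedEmbedding _ e he⟩

theorem LIndLT.subset {L : Type} [TopologicalSpace L] [Nonempty L]
    {α : Ordinal.{0}} {X : Type} [TopologicalSpace X] {A B : Set X} (hA : IsClosed A) (hAB : A ⊆ B)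
    (h : LIndLT L B α) : LIndLT L A α :=
  h.of_isClosedEmbedding (Set.inclusion hAB) (by
    refine ⟨.inclusion hAB, ?_⟩
    rw [range_inclusion]
    exact hA.preimage continuous_subtype_val)

/-- `f` on `F` has a good partition inside `C`. -/
def LGood (L : Type) [TopologicalSpace L] {T : Type} [TopologicalSpace T] (α : Ordinal.{0})
    (F : Set T) (f : T → L) (C : Set T) : Prop :=
  ∃ U : Set T, IsOpen U ∧ U ⊆ C ∧ F ∩ C ⊆ U ∧ ∃ g : T → L, ContinuousOn g U ∧ EqOn g f (F ∩ C) ∧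
    LIndLT L (↥(C \ U)) α

theorem LIndLE_iff_good (L : Type) [TopologicalSpace L] [Nonempty L] (X : Type)
    [TopologicalSpace X] (α : Ordinal.{0}) : LIndLE L X α ↔
    ∀ F : Set X, IsClosed F → ∀ f : X → L, ContinuousOn f F → LGood L α F f univ := by
  rw [LIndLE_iff]
  have key : ∀ U : Set X, LIndLT L ↥(Set.univ \ U) α ↔ LIndLT L ↥(Uᶜ) α := by
    intro U
    rw [← compl_eq_univ_sdiff]
  simp only [LGood, inter_univ, subset_univ, true_and, key]

theorem LGood.subset {L : Type} [TopologicalSpace L] [Nonempty L] {T : Type} [TopologicalSpace T]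
    {α : Ordinal.{0}} {F : Set T} {f : T → L} {C D : Set T} (hD : IsClopen D) (hDC : D ⊆ C)
    (h : LGood L α F f C) : LGood L α F f D := by
  obtain ⟨U, hU, hUC, hFU, g, hg, hgf, h⟩ := h
  refine ⟨U ∩ D, hU.inter hD.2, inter_subset_right, fun x hx => ⟨hFU ⟨hx.1, hDC hx.2⟩, hx.2⟩, g,
    hg.mono inter_subset_left, fun x hx => hgf ⟨hx.1, hDC hx.2⟩, ?_⟩
  refine h.subset (hD.1.sdiff (hU.inter hD.2)) ?_
  intro x hx
  exact ⟨hDC hx.1, fun h => hx.2 ⟨h, hx.1⟩⟩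

theorem LGood.of_LIndLE {L : Type} [TopologicalSpace L] [Nonempty L] {T : Type}
    [TopologicalSpace T] {α : Ordinal.{0}} {F : Set T} (hF : IsClosed F) {f : T → L}
    (hf : ContinuousOn f F) {C : Set T} (hC : IsClopen C) (h : LIndLE L C α) :
    LGood L α F f C := by
  rw [LIndLE_iff] at h
  obtain ⟨U, hU, hFU, g, hg, hgf, h⟩ := h (Subtype.val ⁻¹' F) (hF.preimage continuous_subtype_val)
    (f ∘ Subtype.val) (hf.comp continuous_subtype_val.continuousOn fun x hx => hx)
  refine ⟨Subtype.val '' U, hC.2.isOpenMap_subtype_val U hU, by rintro _ ⟨x, -, rfl⟩; exact x.2,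
    fun x hx => ⟨⟨x, hx.2⟩, hFU hx.1, rfl⟩,
    fun x => if hx : x ∈ C then g ⟨x, hx⟩ else Classical.arbitrary L, ?_, ?_, ?_⟩
  · rintro _ ⟨x, hx, rfl⟩
    apply ContinuousAt.continuousWithinAt
    rw [← hC.2.isOpenEmbedding_subtypeVal.continuousAt_iff]
    convert hg.continuousAt (hU.mem_nhds hx) using 1
    ext x
    simp
  · intro x hx
    simpa [hx.2] using hgf (x := ⟨x, hx.2⟩) hx.1
  · refine h.of_isClosedEmbedding
      (fun x => ⟨⟨x.1, x.2.1⟩, fun h => x.2.2 ⟨_, h, rfl⟩⟩) ?_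
    refine ⟨⟨?_, ?_⟩, ?_⟩
    · refine IsInducing.of_comp (g := fun y => y.1.1) (by fun_prop) (by fun_prop) ?_
      exact IsInducing.subtypeVal
    · intro x y h
      simpa [Subtype.ext_iff] using h
    · convert isClosed_univ
      rw [range_eq_univ]
      rintro ⟨⟨x, hx⟩, hxU⟩
      exact ⟨⟨x, hx, by rintro ⟨y, hy, rfl⟩; exact hxU hy⟩, rfl⟩
theorem LGood.union_aux {L : Type} [TopologicalSpace L] [Nonempty L] {T : Type}
    [TopologicalSpace T] {α : Ordinal.{0}}
    (hD : ∀ β < α, ∀ (X : Type) [TopologicalSpace X] (A : Set X), IsClopen A →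
      LIndLE L A β → LIndLE L ↥(Aᶜ) β → LIndLE L X β)
    {F : Set T} {f : T → L} {C D : Set T} (hC : IsClopen C) (hDc : IsClopen D)
    (h1 : LGood L α F f C) (h2 : LGood L α F f D) : LGood L α F f (C ∪ D) := by
  replace h2 := h2.subset (hDc.diff hC) sdiff_subset
  obtain ⟨U, hU, hUC, hFU, g, hg, hgf, h⟩ := h1
  obtain ⟨U', hU', hUC', hFU', g', hg', hgf', h'⟩ := h2
  refine ⟨U ∪ U', hU.union hU', ?_, ?_, fun x => if x ∈ C then g x else g' x, ?_, ?_, ?_⟩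
  · exact union_subset_union hUC (hUC'.trans sdiff_subset)
  · rintro x ⟨hx, hxC⟩
    by_cases hxc : x ∈ C
    · exact Or.inl (hFU ⟨hx, hxc⟩)
    · exact Or.inr (hFU' ⟨hx, hxC.resolve_left hxc, hxc⟩)
  · refine ContinuousOn.union_of_isOpen ?_ ?_ hU hU'
    · exact hg.congr fun x hx => if_pos (hUC hx)
    · exact hg'.congr fun x hx => if_neg (hUC' hx).2
  · rintro x ⟨hx, hxC⟩
    by_cases hxc : x ∈ C
    · simpa [hxc] using hgf ⟨hx, hxc⟩
    · simpa [hxc] using hgf' ⟨hx, hxC.resolve_left hxc, hxc⟩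
  · have hcl : IsClosed (C \ U) := hC.1.sdiff hU
    have hcl' : IsClosed ((D \ C) \ U') := (hDc.diff hC).1.sdiff hU'
    have hsub : (C ∪ D) \ (U ∪ U') ⊆ (C \ U) ∪ ((D \ C) \ U') := by
      rintro x ⟨hx, hxU⟩
      simp only [mem_union, mem_sdiff] at *
      tauto
    refine LIndLT.subset ((hC.union hDc).1.sdiff (hU.union hU')) hsub ?_
    rcases h with h | ⟨β, hβ, h⟩
    · rw [Set.isEmpty_coe_sort] at h
      rw [h, empty_union]
      exact h'
    rcases h' with h' | ⟨β', hβ', h'⟩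
    · rw [Set.isEmpty_coe_sort] at h'
      rw [h', union_empty]
      exact Or.inr ⟨β, hβ, h⟩
    refine Or.inr ⟨max β β', max_lt hβ hβ', ?_⟩
    replace h := h.mono (le_max_left β β')
    replace h' := h'.mono (le_max_right β β')
    have hA : IsClopen (Subtype.val ⁻¹' C : Set ↥((C \ U) ∪ ((D \ C) \ U'))) :=
      hC.preimage continuous_subtype_val
    refine hD _ (max_lt hβ hβ') _ (Subtype.val ⁻¹' C) hA ?_ ?_
    · refine h.of_isClosedEmbedding _ (fun x => ⟨x.1.1,
        x.1.2.resolve_right fun h => h.1.2 x.2⟩) ?_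
      refine IsClosedEmbedding.of_comp_iff (hg := hcl.isClosedEmbedding_subtypeVal) |>.1 ?_
      exact (hcl.union hcl').isClosedEmbedding_subtypeVal.comp
        hA.1.isClosedEmbedding_subtypeVal
    · refine h'.of_isClosedEmbedding _ (fun x => ⟨x.1.1,
        x.1.2.resolve_left fun h => x.2 h.1⟩) ?_
      refine IsClosedEmbedding.of_comp_iff (hg := hcl'.isClosedEmbedding_subtypeVal) |>.1 ?_
      exact (hcl.union hcl').isClosedEmbedding_subtypeVal.comp
        hA.compl.1.isClosedEmbedding_subtypeVal

theorem LIndLE.of_clopen {L : Type} [TopologicalSpace L] [Nonempty L] (α : Ordinal.{0}) :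
    ∀ (X : Type) [TopologicalSpace X] (A : Set X), IsClopen A →
      LIndLE L A α → LIndLE L ↥(Aᶜ) α → LIndLE L X α := by
  induction α using WellFoundedLT.induction with
  | ind α ih =>
    intro X _ A hA h h'
    rw [LIndLE_iff_good]
    intro F hF f hf
    rw [← union_compl_self A]
    exact LGood.union_aux ih hA hA.compl (.of_LIndLE hF hf hA h) (.of_LIndLE hF hf hA.compl h')

theorem LGood.union {L : Type} [TopologicalSpace L] [Nonempty L] {T : Type}
    [TopologicalSpace T] {α : Ordinal.{0}}
    {F : Set T} {f : T → L} {C D : Set T} (hC : IsClopen C) (hDc : IsClopen D)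
    (h1 : LGood L α F f C) (h2 : LGood L α F f D) : LGood L α F f (C ∪ D) :=
  LGood.union_aux (fun β _ => LIndLE.of_clopen β) hC hDc h1 h2

theorem LGood.empty {L : Type} [TopologicalSpace L] [Nonempty L] {T : Type}
    [TopologicalSpace T] {α : Ordinal.{0}} {F : Set T} {f : T → L} : LGood L α F f ∅ :=
  ⟨∅, isOpen_empty, le_rfl, by simp, f, by simp, by simp, Or.inl (by simp)⟩

theorem LGood.biUnion {L : Type} [TopologicalSpace L] [Nonempty L] {T ι : Type}
    [TopologicalSpace T] {α : Ordinal.{0}} {F : Set T} {f : T → L} (C : ι → Set T)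
    (s : Finset ι) (hC : ∀ i ∈ s, IsClopen (C i)) (h : ∀ i ∈ s, LGood L α F f (C i)) :
    LGood L α F f (⋃ i ∈ s, C i) := by
  induction s using Finset.induction_on with
  | empty => simpa using LGood.empty
  | insert a s ha ih =>
    rw [Finset.set_biUnion_insert]
    refine LGood.union (hC a (by simp)) ?_ (h a (by simp)) (ih (fun i hi => hC i (by simp [hi]))
      (fun i hi => h i (by simp [hi])))
    exact s.finite_toSet.isClopen_biUnion fun i hi => hC i (by simp_all)

/-! ### Consequences of the ANR property -/

theorem anr_data {L : Type} [MetricSpace L] [CompactSpace L] [Nonempty L] (hANR : IsANR L) :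
    ∃ (e : L → ℕ → ℝ) (U : Set (ℕ → ℝ)) (r : (ℕ → ℝ) → L), Continuous e ∧ IsOpen U ∧
      (∀ a, e a ∈ U) ∧ ContinuousOn r U ∧ ∀ a, r (e a) = a := by
  let e : L → ℕ → ℝ := fun a n => dist a (TopologicalSpace.denseSeq L n)
  have hec : Continuous e := by fun_prop
  have hei : Function.Injective e := by
    intro a b hab
    by_contra hne
    have hpos : 0 < dist a b := dist_pos.2 hne
    obtain ⟨n, hn⟩ := (TopologicalSpace.denseRange_denseSeq L).exists_dist_lt a (half_pos hpos)
    have h1 : dist a (TopologicalSpace.denseSeq L n) = dist b (TopologicalSpace.denseSeq L n) :=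
      congrFun hab n
    have := dist_triangle_right a b (TopologicalSpace.denseSeq L n)
    linarith
  have hE : IsClosedEmbedding e := hec.isClosedEmbedding hei
  let _ : MetricSpace (ℕ → ℝ) := TopologicalSpace.metrizableSpaceMetric (ℕ → ℝ)
  obtain ⟨U, hU, hAU, r, hr⟩ := hANR.2 (ℕ → ℝ) (range e) hE.isClosed_range
    hE.isEmbedding.toHomeomorph.symm
  refine ⟨e, U, fun x => if hx : x ∈ U then r ⟨x, hx⟩ else Classical.arbitrary L, hec, hU,
    fun a => hAU (mem_range_self a), ?_, ?_⟩
  · rw [continuousOn_iff_continuous_domRestrict]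
    convert r.continuous using 1
    ext x
    simp
  · intro a
    have := hr (e a) (mem_range_self a)
    simp only [hAU (mem_range_self a), dif_pos]
    rw [this]
    exact hE.isEmbedding.toHomeomorph.symm_apply_apply a

theorem anr_extend {L : Type} [MetricSpace L] [CompactSpace L] [Nonempty L] (hANR : IsANR L)
    {T : Type} [TopologicalSpace T] [NormalSpace T] {F : Set T} (hF : IsClosed F) {f : T → L}
    (hf : ContinuousOn f F) :
    ∃ O : Set T, IsOpen O ∧ F ⊆ O ∧ ∃ g : T → L, ContinuousOn g O ∧ EqOn g f F := by
  obtain ⟨e, U, r, he, hU, heU, hr, hre⟩ := anr_data hANR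
  obtain ⟨G, hG⟩ := ContinuousMap.exists_restrict_eq hF
    (⟨F.domRestrict (e ∘ f), continuousOn_iff_continuous_domRestrict.1 (he.comp_continuousOn hf)⟩ :
      C(F, ℕ → ℝ))
  have hG' : ∀ x ∈ F, G x = e (f x) := fun x hx => congrArg (fun k => k ⟨x, hx⟩) hG
  refine ⟨G ⁻¹' U, hU.preimage G.continuous, ?_, r ∘ G,
    hr.comp G.continuous.continuousOn fun x hx => hx, ?_⟩
  · intro x hx
    change G x ∈ U
    rw [hG' x hx]
    exact heU _
  · intro x hx
    simp [hG' x hx, hre]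

theorem anr_equiconn {L : Type} [MetricSpace L] [CompactSpace L] [Nonempty L] (hANR : IsANR L) :
    ∃ (D : Set (L × L)) (lam : (L × L) × unitInterval → L), IsOpen D ∧ (∀ a, (a, a) ∈ D) ∧
      ContinuousOn lam (D ×ˢ Set.univ) ∧ (∀ a b, lam ((a, b), 0) = a) ∧ ∀ a b, lam ((a, b), 1) = b := by
  obtain ⟨e, U, r, he, hU, heU, hr, hre⟩ := anr_data hANR
  let m : (L × L) × unitInterval → ℕ → ℝ := fun p =>
    (1 - (p.2 : ℝ)) • e p.1.1 + (p.2 : ℝ) • e p.1.2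
  have hm : Continuous m := by fun_prop
  obtain ⟨D, v, hD, hv, hdD, hv', hDv⟩ := generalized_tube_lemma
    (s := range fun a : L => (a, a)) (t := (univ : Set unitInterval))
    (isCompact_range (by fun_prop)) isCompact_univ (hU.preimage hm) (by
      rintro ⟨_, t⟩ ⟨⟨a, rfl⟩, -⟩
      have : m ((a, a), t) = e a := by
        simp only [m, ← add_smul]
        simp
      change m ((a, a), t) ∈ U
      rw [this]
      exact heU a)
  refine ⟨D, r ∘ m, hD, fun a => hdD ⟨a, rfl⟩, hr.comp hm.continuousOn ?_, ?_, ?_⟩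
  · intro p hp
    exact hDv ⟨hp.1, hv' hp.2⟩
  · intro a b; simp [m, hre]
  · intro a b; simp [m, hre]
theorem transition {L : Type} [MetricSpace L] [CompactSpace L] [Nonempty L] (hANR : IsANR L)
    {T X : Type} [TopologicalSpace T] [TopologicalSpace X] [CompactSpace T] [T2Space T]
    [CompactSpace X] (q : T → X) (j : X → T) (hq : Continuous q)
    (hj : Continuous j) (hqj : ∀ x, q (j x) = x) {F : Set T} (hF : IsClosed F) {f : T → L}
    (hf : ContinuousOn f F) :
    ∃ (E : Set X) (h : X → L) (N : Set T), IsClosed E ∧ ContinuousOn h E ∧ IsOpen N ∧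
      (∀ x, j x ∈ N) ∧ (∀ z ∈ F ∩ N, q z ∈ E) ∧
      ∀ (U : Set X) (g : X → L), IsOpen U → E ⊆ U → ContinuousOn g U → EqOn g h E →
        ∃ G : T → L, ContinuousOn G (q ⁻¹' U ∩ N) ∧ EqOn G f (F ∩ N) := by
  obtain ⟨D, lam, hD, hdD, hlam, hlam0, hlam1⟩ := anr_equiconn hANR
  obtain ⟨O, hO, hFO, ft, hft, hftf⟩ := anr_extend hANR hF hf
  obtain ⟨V, hV, hFV, hVO⟩ := normal_exists_closure_subset hF hO hFO
  obtain ⟨V1, hV1, hFV1, hV1V⟩ := normal_exists_closure_subset hF hV hFV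
  have hE : IsClosed (j ⁻¹' closure V) := isClosed_closure.preimage hj
  have hh : ContinuousOn (ft ∘ j) (j ⁻¹' closure V) :=
    hft.comp hj.continuousOn fun x hx => hVO hx
  have hB1 : IsClosed (closure V1 ∩ q ⁻¹' (j ⁻¹' V)ᶜ) :=
    isClosed_closure.inter ((hV.preimage hj).isClosed_compl.preimage hq)
  have hcl : IsClosed (closure V1 ∩ q ⁻¹' (j ⁻¹' closure V)) :=
    isClosed_closure.inter (hE.preimage hq)
  have hB2 : IsClosed ((closure V1 ∩ q ⁻¹' (j ⁻¹' closure V)) ∩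
      (fun z => (ft z, ft (j (q z)))) ⁻¹' Dᶜ) := by
    refine ContinuousOn.preimage_isClosed_of_isClosed ?_ hcl hD.isClosed_compl
    refine ContinuousOn.prodMk ?_ ?_
    · exact hft.mono fun z hz => hVO (subset_closure (hV1V hz.1))
    · exact hh.comp hq.continuousOn fun z hz => hz.2
  obtain ⟨u, hu0, hu1, hu⟩ := exists_continuous_zero_one_of_isClosed hF hV1.isClosed_compl
    (disjoint_compl_right_iff_subset.2 hFV1)
  let u' : T → unitInterval := fun z => ⟨u z, hu z⟩
  have hu' : Continuous u' := by fun_prop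
  have hNE : ∀ z ∈ closure V1, z ∈ ((closure V1 ∩ q ⁻¹' (j ⁻¹' V)ᶜ) ∪
      ((closure V1 ∩ q ⁻¹' (j ⁻¹' closure V)) ∩ (fun z => (ft z, ft (j (q z)))) ⁻¹' Dᶜ))ᶜ →
      q z ∈ j ⁻¹' closure V ∧ (ft z, ft (j (q z))) ∈ D := by
    intro z hz hzN
    simp only [mem_compl_iff, mem_union, mem_inter_iff, mem_preimage, not_or, not_and,
      not_not] at hzN
    have h1 := subset_closure (hzN.1 hz)
    exact ⟨h1, hzN.2 ⟨hz, h1⟩⟩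
  refine ⟨j ⁻¹' closure V, ft ∘ j, _, hE, hh, (hB1.union hB2).isOpen_compl, ?_, ?_, ?_⟩
  · rintro x (⟨h1, h2⟩ | ⟨h1, h2⟩)
    · apply h2
      rw [hqj]
      exact hV1V h1
    · apply h2
      simp only [hqj]
      exact hdD _
  · rintro z ⟨hz, hzN⟩
    exact (hNE z (subset_closure (hFV1 hz)) hzN).1
  · intro U g hU hEU hg hgh
    refine ⟨fun z => if z ∈ closure V1 then lam ((ft z, g (q z)), u' z) else g (q z), ?_, ?_⟩
    · set N := ((closure V1 ∩ q ⁻¹' (j ⁻¹' V)ᶜ) ∪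
        ((closure V1 ∩ q ⁻¹' (j ⁻¹' closure V)) ∩ (fun z => (ft z, ft (j (q z)))) ⁻¹' Dᶜ))ᶜ
        with hN
      have hgq : ContinuousOn (g ∘ q) (q ⁻¹' U) := hg.comp hq.continuousOn fun z hz => hz
      have c1 : ContinuousOn (fun z => lam ((ft z, g (q z)), u' z))
          (q ⁻¹' U ∩ N ∩ closure V1) := by
        refine hlam.comp (t := D ×ˢ Set.univ) ?_ ?_
        · refine ContinuousOn.prodMk (ContinuousOn.prodMk ?_ ?_) hu'.continuousOn
          · exact hft.mono fun z hz => hVO (subset_closure (hV1V hz.2))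
          · exact hgq.mono fun z hz => hz.1.1
        · intro z hz
          have := hNE z hz.2 hz.1.2
          refine ⟨?_, mem_univ _⟩
          change (ft z, g (q z)) ∈ D
          rw [hgh this.1]
          exact this.2
      intro z hz
      have hsplit : q ⁻¹' U ∩ N = (q ⁻¹' U ∩ N ∩ closure V1) ∪ (q ⁻¹' U ∩ N ∩ V1ᶜ) := by
        rw [← inter_union_distrib_left]
        symm
        rw [inter_eq_left]
        intro w _
        by_cases hw : w ∈ V1
        · exact Or.inl (subset_closure hw)
        · exact Or.inr hw
      have e1 : EqOn (fun z => if z ∈ closure V1 then lam ((ft z, g (q z)), u' z) else g (q z))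
          (fun z => lam ((ft z, g (q z)), u' z)) (q ⁻¹' U ∩ N ∩ closure V1) := by
        intro w hw
        simp [hw.2]
      have e2 : EqOn (fun z => if z ∈ closure V1 then lam ((ft z, g (q z)), u' z) else g (q z))
          (g ∘ q) (q ⁻¹' U ∩ N ∩ V1ᶜ) := by
        intro w hw
        have hw1 : u' w = 1 := Subtype.ext (hu1 hw.2)
        by_cases hwc : w ∈ closure V1
        · simp [hwc, hw1, hlam1]
        · simp [hwc]
      rw [hsplit]
      apply ContinuousWithinAt.union
      · by_cases hzc : z ∈ closure V1
        · exact (c1.congr e1) z ⟨hz, hzc⟩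
        · apply continuousWithinAt_of_notMem_closure
          intro hcc
          exact hzc (closure_minimal inter_subset_right isClosed_closure hcc)
      · by_cases hzc : z ∈ V1ᶜ
        · exact ((hgq.mono fun w hw => hw.1.1).congr e2) z ⟨hz, hzc⟩
        · apply continuousWithinAt_of_notMem_closure
          intro hcc
          exact hzc (closure_minimal inter_subset_right hV1.isClosed_compl hcc)
    · rintro z ⟨hz, hzN⟩
      have hz0 : u' z = 0 := Subtype.ext (hu0 hz)
      have := subset_closure (hFV1 hz)
      simp [this, hz0, hlam0, hftf hz]

theorem LIndLE.prod {L : Type} [MetricSpace L] [CompactSpace L] [Nonempty L] (hANR : IsANR L)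
    (S : Type) [TopologicalSpace S] [CompactSpace S] [T2Space S] [TotallyDisconnectedSpace S]
    (α : Ordinal.{0}) : ∀ (Y : Type) [TopologicalSpace Y] [CompactSpace Y] [T2Space Y],
      LIndLE L Y α → LIndLE L (S × Y) α := by
  induction α using WellFoundedLT.induction with
  | ind α ih =>
    intro Y _ _ _ hY
    rw [LIndLE_iff_good]
    intro F hF f hf
    have key : ∃ C : Set S, IsClopen C ∧ Set.univ ⊆ C ∧ LGood L α F f (Prod.fst ⁻¹' C) := by
      refine IsCompact.induction_on (p := fun A => ∃ C : Set S, IsClopen C ∧ A ⊆ C ∧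
        LGood L α F f (Prod.fst ⁻¹' C)) isCompact_univ ?_ ?_ ?_ ?_
      · exact ⟨∅, isClopen_empty, le_rfl, by simpa using LGood.empty⟩
      · rintro s t hst ⟨C, hC, htC, h⟩
        exact ⟨C, hC, hst.trans htC, h⟩
      · rintro s t ⟨C, hC, hsC, h⟩ ⟨C', hC', htC', h'⟩
        refine ⟨C ∪ C', hC.union hC', union_subset_union hsC htC', ?_⟩
        rw [preimage_union]
        exact h.union (hC.preimage continuous_fst) (hC'.preimage continuous_fst) h'
      · intro s _
        obtain ⟨E, h, N, hE, hh, hN, hjN, hFN, H⟩ := transition hANR (T := S × Y) (X := Y)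
          Prod.snd (fun y => (s, y)) continuous_snd (by fun_prop) (fun _ => rfl) hF hf
        rw [LIndLE_iff] at hY
        obtain ⟨U, hU, hEU, g, hg, hgh, hP⟩ := hY E hE h hh
        obtain ⟨G, hG, hGf⟩ := H U g hU hEU hg hgh
        obtain ⟨O, v, hO, -, hsO, hv, hOv⟩ := generalized_tube_lemma (s := {s})
          (t := (Set.univ : Set Y)) isCompact_singleton isCompact_univ hN (by
            rintro ⟨s', y⟩ ⟨hs', -⟩
            obtain rfl : s' = s := hs'
            exact hjN y)
        obtain ⟨C, hC, hsC, hCO⟩ := compact_exists_isClopen_in_isOpen hO (hsO rfl)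
        have hCN : ∀ z : S × Y, z.1 ∈ C → z ∈ N := fun z hz => hOv ⟨hCO hz, hv (mem_univ _)⟩
        refine ⟨C, mem_nhdsWithin_of_mem_nhds (hC.2.mem_nhds hsC), C, hC, le_rfl,
          Prod.fst ⁻¹' C ∩ Prod.snd ⁻¹' U, (hC.2.preimage continuous_fst).inter
          (hU.preimage continuous_snd), inter_subset_left, ?_, G, ?_, ?_, ?_⟩
        · intro z hz
          exact ⟨hz.2, hEU (hFN z ⟨hz.1, hCN z hz.2⟩)⟩
        · exact hG.mono fun z hz => ⟨hz.2, hCN z hz.1⟩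
        · exact fun z hz => hGf ⟨hz.1, hCN z hz.2⟩
        · have hP' : LIndLT L (S × ↥(Uᶜ)) α := by
            have : CompactSpace ↥(Uᶜ) := isCompact_iff_compactSpace.1 hU.isClosed_compl.isCompact
            rcases hP with hP | ⟨β, hβ, hP⟩
            · left; infer_instance
            · exact Or.inr ⟨β, hβ, ih β hβ _ hP⟩
          have hcl : IsClosed (Prod.fst ⁻¹' C \ (Prod.fst ⁻¹' C ∩ Prod.snd ⁻¹' U) : Set (S × Y)) :=
            (hC.1.preimage continuous_fst).sdiff ((hC.2.preimage continuous_fst).inter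
              (hU.preimage continuous_snd))
          have := isCompact_iff_compactSpace.1 hcl.isCompact
          let e : ↥(Prod.fst ⁻¹' C \ (Prod.fst ⁻¹' C ∩ Prod.snd ⁻¹' U) : Set (S × Y)) →
            S × ↥(Uᶜ) := fun z => (z.1.1, ⟨z.1.2, fun h => z.2.2 ⟨z.2.1, h⟩⟩)
          refine hP'.of_isClosedEmbedding e ?_
          refine Continuous.isClosedEmbedding (by fun_prop) ?_
          rintro ⟨⟨a, b⟩, h1⟩ ⟨⟨c, d⟩, h2⟩ h
          simpa [e, Subtype.ext_iff] using h
    obtain ⟨C, hC, hCu, h⟩ := key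
    rwa [univ_subset_iff.1 hCu, preimage_univ] at h
section ZFacts

variable {ι X Y : Type} [TopologicalSpace ι] [TopologicalSpace X] [TopologicalSpace Y]

/-- Projection of `N` to `A_𝔪`. -/
def ZQuotProjA : ZQuot ι X Y → OnePoint ι :=
  Quot.lift (fun p => p.1) (fun _ _ h => h.1.trans h.2.1.symm)

/-- The `Y`-coordinate on the `i`-th level, constant elsewhere. -/
def ZQuotProjY (y0 : Y) (i : ι) : ZQuot ι X Y → Y :=
  Quot.lift (fun p => if p.1 = (i : OnePoint ι) then p.2.2 else y0) (fun p q h => by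
    have h1 : p.1 ≠ (i : OnePoint ι) := by rw [h.1]; exact OnePoint.infty_ne_coe i
    have h2 : q.1 ≠ (i : OnePoint ι) := by rw [h.2.1]; exact OnePoint.infty_ne_coe i
    simp [h1, h2])

theorem continuous_ZQuotProjX : Continuous (ZQuotProjX : ZQuot ι X Y → X) :=
  continuous_quot_lift _ (by fun_prop)

theorem continuous_ZQuotProjA : Continuous (ZQuotProjA : ZQuot ι X Y → OnePoint ι) :=
  continuous_quot_lift _ (by fun_prop)

theorem isClopen_onePoint_coe [DiscreteTopology ι] (i : ι) : IsClopen ({(i : OnePoint ι)} : Set (OnePoint ι)) := by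
  refine ⟨isClosed_singleton, ?_⟩
  have := OnePoint.isOpenEmbedding_coe (X := ι) |>.isOpenMap {i} (isOpen_discrete _)
  simpa using this

theorem continuous_ZQuotProjY [DiscreteTopology ι] (y0 : Y) (i : ι) :
    Continuous (ZQuotProjY y0 i : ZQuot ι X Y → Y) := by
  refine continuous_quot_lift _ ?_
  refine Continuous.if (p := fun p : OnePoint ι × X × Y => p.1 = (i : OnePoint ι)) ?_
    (by fun_prop) continuous_const
  have h : IsClopen {p : OnePoint ι × X × Y | p.1 = (i : OnePoint ι)} :=
    (isClopen_onePoint_coe i).preimage continuous_fst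
  rw [h.frontier_eq]
  simp

theorem ZQuot_ext (y0 : Y) {z w : ZQuot ι X Y} (h1 : ZQuotProjX z = ZQuotProjX w)
    (h2 : ZQuotProjA z = ZQuotProjA w) (h3 : ∀ i, ZQuotProjY y0 i z = ZQuotProjY y0 i w) :
    z = w := by
  induction z using Quot.ind with | mk p
  induction w using Quot.ind with | mk p'
  obtain ⟨a, x, y⟩ := p
  obtain ⟨a', x', y'⟩ := p'
  change x = x' at h1
  change a = a' at h2
  subst h1 h2
  induction a using OnePoint.rec with
  | infty => exact Quot.sound ⟨rfl, rfl, rfl⟩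
  | coe i =>
    have := h3 i
    simp only [ZQuotProjY, if_true] at this
    rw [this]

theorem ZQuot_t2 [DiscreteTopology ι] [T2Space X] [T2Space Y] [Nonempty Y] :
    T2Space (ZQuot ι X Y) := by
  let y0 := Classical.arbitrary Y
  refine T2Space.of_injective_continuous
    (f := fun z : ZQuot ι X Y => (ZQuotProjX z, ZQuotProjA z, fun i => ZQuotProjY y0 i z)) ?_ ?_
  · intro z w h
    simp only [Prod.mk.injEq] at h
    exact ZQuot_ext y0 h.1 h.2.1 (fun i => congrFun h.2.2 i)
  · exact continuous_ZQuotProjX.prodMk (continuous_ZQuotProjA.prodMk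
      (continuous_pi fun i => continuous_ZQuotProjY y0 i))

theorem mem_ZSet (φ : ι → Set X) (z : ZQuot ι X Y) :
    z ∈ ZSet ι X Y φ ↔ ∀ i : ι, ZQuotProjA z = i → ZQuotProjX z ∈ φ i := by
  constructor
  · rintro ⟨p, rfl, h | ⟨k, hk, h⟩⟩ i hi
    · change p.1 = _ at hi
      rw [h] at hi
      exact absurd hi (OnePoint.infty_ne_coe i)
    · change p.1 = _ at hi
      rw [hk, OnePoint.coe_eq_coe] at hi
      rw [← hi]
      exact h
  · intro h
    induction z using Quot.ind with | mk p
    refine ⟨p, rfl, ?_⟩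
    rcases Classical.em (p.1 = OnePoint.infty) with hp | hp
    · exact Or.inl hp
    · obtain ⟨i, hi⟩ := OnePoint.ne_infty_iff_exists.1 hp
      exact Or.inr ⟨i, hi.symm, h i hi.symm⟩

theorem isClosed_ZSet [DiscreteTopology ι] (φ : ι → Set X) (hφ : ∀ i, IsClosed (φ i)) :
    IsClosed (ZSet ι X Y φ) := by
  have : ZSet ι X Y φ = ⋂ i : ι, ((ZQuotProjA ⁻¹' {(i : OnePoint ι)})ᶜ ∪ ZQuotProjX ⁻¹' (φ i)) := by
    ext z
    rw [mem_ZSet]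
    simp only [mem_iInter, mem_union, mem_compl_iff, mem_preimage, mem_singleton_iff, imp_iff_not_or]
  rw [this]
  refine isClosed_iInter fun i => IsClosed.union ?_ ((hφ i).preimage continuous_ZQuotProjX)
  exact ((isClopen_onePoint_coe i).2.preimage continuous_ZQuotProjA).isClosed_compl

end ZFacts

theorem SFam_facts {X : Type} [TopologicalSpace X] [T2Space X] {S : Set X} (hS : S ∈ SFam X) :
    IsCompact S ∧ TotallyDisconnectedSpace S := by
  rcases hS with h | ⟨⟨e⟩⟩
  · refine ⟨h.isCompact, ?_⟩
    have := h.to_subtype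
    infer_instance
  · have h1 : CompactSpace S := e.symm.compactSpace
    refine ⟨isCompact_iff_compactSpace.2 h1, ?_⟩
    exact e.isEmbedding.isTotallyDisconnected_range.1 (isTotallyDisconnected_of_totallyDisconnectedSpace _)
theorem exists_sep {X : Type} [TopologicalSpace X] {S K U : Set X} [CompactSpace S] [T2Space S]
    [TotallyDisconnectedSpace S] (hK : IsClosed K) (hU : IsOpen U) (hKU : K ⊆ U) :
    ∃ O C : Set X, IsOpen O ∧ IsClosed C ∧ (∀ x ∈ S, x ∈ O ↔ x ∈ C) ∧ K ∩ S ⊆ O ∧ O ∩ S ⊆ U := by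
  obtain ⟨W, hW, hKW, hWU⟩ := exists_clopen_of_closed_subset_open (X := S)
    (hK.preimage continuous_subtype_val) (hU.preimage continuous_subtype_val)
    (fun x hx => hKU hx)
  obtain ⟨O, hO, hOW⟩ := isOpen_induced_iff.1 hW.2
  obtain ⟨C, hC, hCW⟩ := isClosed_induced_iff.1 hW.1
  refine ⟨O, C, hO, hC, ?_, ?_, ?_⟩
  · intro x hx
    have h1 : (⟨x, hx⟩ : S) ∈ Subtype.val ⁻¹' O ↔ (⟨x, hx⟩ : S) ∈ Subtype.val ⁻¹' C := by
      rw [hOW, hCW]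
    exact h1
  · rintro x ⟨hx, hxS⟩
    have : (⟨x, hxS⟩ : S) ∈ W := hKW hx
    rw [← hOW] at this
    exact this
  · rintro x ⟨hx, hxS⟩
    have : (⟨x, hxS⟩ : S) ∈ W := by
      rw [← hOW]
      exact hx
    exact hWU this

theorem LIndLE_Z {L : Type} [MetricSpace L] [CompactSpace L] [Nonempty L]
    (hANR : IsANR L) {X Y : Type} [TopologicalSpace X] [TopologicalSpace Y]
    [CompactSpace X] [CompactSpace Y] [T2Space X] [T2Space Y] [Nonempty Y]
    {ι : Type} [TopologicalSpace ι] [DiscreteTopology ι] (φ : ι → Set X)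
    (hφ : ∀ i, φ i ∈ SFam X) {a b γ : Ordinal.{0}} (hX : LIndLE L X a) (hY : LIndLE L Y b)
    (haγ : a < γ) (hbγ : b ≤ γ) : LIndLE L (ZSpace ι X Y φ) γ := by
  let y0 := Classical.arbitrary Y
  have hφc : ∀ i, IsClosed (φ i) := fun i => (SFam_facts (hφ i)).1.isClosed
  have hφcs : ∀ i, CompactSpace (φ i) := fun i =>
    isCompact_iff_compactSpace.1 (SFam_facts (hφ i)).1
  have hφtd : ∀ i, TotallyDisconnectedSpace (φ i) := fun i => (SFam_facts (hφ i)).2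
  have : T2Space (ZQuot ι X Y) := ZQuot_t2
  have : CompactSpace (ZSpace ι X Y φ) :=
    isCompact_iff_compactSpace.1 (isClosed_ZSet φ hφc).isCompact
  let q : ZSpace ι X Y φ → X := fun z => ZQuotProjX z.1
  let p : ZSpace ι X Y φ → OnePoint ι := fun z => ZQuotProjA z.1
  have hq : Continuous q := continuous_ZQuotProjX.comp continuous_subtype_val
  have hp : Continuous p := continuous_ZQuotProjA.comp continuous_subtype_val
  have hqp : ∀ z (i : ι), p z = (i : OnePoint ι) → q z ∈ φ i := fun z i h => (mem_ZSet φ z.1).1 z.2 i h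
  let j : X → ZSpace ι X Y φ := fun x => ⟨Quot.mk _ (OnePoint.infty, x, y0),
    (OnePoint.infty, x, y0), rfl, Or.inl rfl⟩
  have hj : Continuous j :=
    (continuous_quot_mk.comp (by fun_prop : Continuous fun x : X =>
      ((OnePoint.infty : OnePoint ι), x, y0))).subtype_mk _
  have hqj : ∀ x, q (j x) = x := fun x => rfl
  have hjq : ∀ z, p z = OnePoint.infty → j (q z) = z := by
    intro z hz
    apply Subtype.ext
    refine ZQuot_ext y0 (hqj (q z)) hz.symm fun i => ?_
    have aux : ∀ w : ZQuot ι X Y, ZQuotProjA w = OnePoint.infty → ZQuotProjY y0 i w = y0 := by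
      intro w hw
      induction w using Quot.ind with | mk w
      change w.1 = _ at hw
      simp only [ZQuotProjY, hw, OnePoint.infty_ne_coe, if_false]
    rw [aux _ hz]
    exact aux _ rfl
  have hHc : ∀ i : ι, IsClopen (p ⁻¹' {(i : OnePoint ι)}) :=
    fun i => (isClopen_onePoint_coe i).preimage hp
  rw [LIndLE_iff_good]
  intro F hF f hf
  have hH : ∀ i : ι, LGood L γ F f (p ⁻¹' {(i : OnePoint ι)}) := by
    intro i
    refine LGood.of_LIndLE hF hf (hHc i) ?_
    have h1 : LIndLE L (φ i × Y) γ := (LIndLE.prod hANR (φ i) b Y hY).mono hbγ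
    have := isCompact_iff_compactSpace.1 (hHc i).1.isCompact
    let e : ↥(p ⁻¹' {(i : OnePoint ι)}) → φ i × Y :=
      fun z => (⟨q z.1, hqp z.1 i z.2⟩, ZQuotProjY y0 i z.1.1)
    refine h1.of_isClosedEmbedding _ e (Continuous.isClosedEmbedding ?_ ?_)
    · refine Continuous.prodMk ((hq.comp continuous_subtype_val).subtype_mk _) ?_
      exact (continuous_ZQuotProjY y0 i).comp (continuous_subtype_val.comp continuous_subtype_val)
    · intro z w hzw
      simp only [e, Prod.mk.injEq, Subtype.mk.injEq] at hzw
      apply Subtype.ext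
      apply Subtype.ext
      have hzi : ZQuotProjA z.1.1 = (i : OnePoint ι) := z.2
      have hwi : ZQuotProjA w.1.1 = (i : OnePoint ι) := w.2
      refine ZQuot_ext y0 hzw.1 (hzi.trans hwi.symm) fun k => ?_
      by_cases hk : k = i
      · subst hk; exact hzw.2
      · have aux : ∀ v : ZQuot ι X Y, ZQuotProjA v = (i : OnePoint ι) →
            ZQuotProjY y0 k v = y0 := by
          intro v hv
          induction v using Quot.ind with | mk v
          change v.1 = _ at hv
          have : ¬ i = k := fun h => hk h.symm
          simp [ZQuotProjY, hv, OnePoint.coe_eq_coe, this]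
        rw [aux _ hzi, aux _ hwi]
  obtain ⟨E, h, N, hE, hh, hN, hjN, hFN, H⟩ := transition hANR q j hq hj hqj hF hf
  obtain ⟨U, hU, hEU, g, hg, hgh⟩ := anr_extend hANR hE hh
  obtain ⟨G, hG, hGf⟩ := H U g hU hEU hg hgh
  obtain ⟨V, hV, hEV, hVU⟩ := normal_exists_closure_subset hE hU hEU
  -- only finitely many levels meet the complement of `N`
  obtain ⟨Φ, hΦ⟩ := hN.isClosed_compl.isCompact.elim_finite_subcover
    (fun i : ι => p ⁻¹' {(i : OnePoint ι)}) (fun i => (hHc i).2) (by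
      intro z hz
      have hzi : p z ≠ OnePoint.infty := by
        intro hzi
        apply hz
        rw [← hjq z hzi]
        exact hjN _
      obtain ⟨i, hi⟩ := OnePoint.ne_infty_iff_exists.1 hzi
      exact mem_iUnion.2 ⟨i, hi.symm⟩)
  set R : Set (ZSpace ι X Y φ) := (⋃ i ∈ Φ, p ⁻¹' {(i : OnePoint ι)})ᶜ with hR
  have hΦc : IsClopen (⋃ i ∈ Φ, p ⁻¹' {(i : OnePoint ι)}) :=
    Φ.finite_toSet.isClopen_biUnion fun i _ => hHc i
  have hRc : IsClopen R := hΦc.compl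
  have hRN : R ⊆ N := compl_subset_comm.1 hΦ
  have hgoodR : LGood L γ F f R := by
    choose O C hO hC hOC hKO hOU using fun i : ι =>
      exists_sep (S := φ i) (K := closure V) isClosed_closure hU hVU
    let A : Set (ZSpace ι X Y φ) := R ∩ (q ⁻¹' V ∪ ⋃ i : ι, p ⁻¹' {(i : OnePoint ι)} ∩ q ⁻¹' (O i))
    let B : Set (ZSpace ι X Y φ) := R ∩ ⋃ i : ι, p ⁻¹' {(i : OnePoint ι)} ∩ q ⁻¹' (C i)ᶜ
    have hA : IsOpen A := hRc.2.inter ((hV.preimage hq).union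
      (isOpen_iUnion fun i => (hHc i).2.inter ((hO i).preimage hq)))
    have hB : IsOpen B := hRc.2.inter
      (isOpen_iUnion fun i => (hHc i).2.inter ((hC i).isOpen_compl.preimage hq))
    have hAO : ∀ z ∈ A, ∀ i : ι, p z = i → q z ∈ O i := by
      rintro z ⟨-, hz | hz⟩ i hi
      · exact hKO i ⟨subset_closure hz, hqp z i hi⟩
      · obtain ⟨k, hk, hz⟩ := mem_iUnion.1 hz
        have : (k : OnePoint ι) = i := (show p z = k from hk).symm.trans hi
        rw [OnePoint.coe_eq_coe] at this
        subst this
        exact hz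
    have hAB : ∀ z ∈ A, z ∉ B := by
      rintro z hzA ⟨-, hzB⟩
      obtain ⟨i, hi, hz⟩ := mem_iUnion.1 hzB
      exact hz ((hOC i _ (hqp z i hi)).1 (hAO z hzA i hi))
    have hAU : A ⊆ q ⁻¹' U ∩ N := by
      intro z hz
      refine ⟨?_, hRN hz.1⟩
      rcases hz.2 with h | h
      · exact hVU (subset_closure h)
      · obtain ⟨i, hi, h⟩ := mem_iUnion.1 h
        exact hOU i ⟨h, hqp z i hi⟩
    have hFA : F ∩ R ⊆ A := fun z hz => ⟨hz.2, Or.inl (hEV (hFN z ⟨hz.1, hRN hz.2⟩))⟩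
    refine ⟨A ∪ B, hA.union hB, union_subset inter_subset_left inter_subset_left,
      hFA.trans subset_union_left, fun z => if z ∈ B then Classical.arbitrary L else G z,
      ContinuousOn.union_of_isOpen ?_ ?_ hA hB, ?_, ?_⟩
    · exact (hG.mono hAU).congr fun z hz => if_neg (hAB z hz)
    · exact (continuousOn_const (c := Classical.arbitrary L)).congr fun z hz => if_pos hz
    · intro z hz
      have := hAB z (hFA hz)
      simp only [this, if_false]
      exact hGf ⟨hz.1, hRN hz.2⟩
    · have hcl : IsClosed (R \ (A ∪ B)) := hRc.1.sdiff (hA.union hB)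
      have hinf : ∀ z ∈ R \ (A ∪ B), p z = OnePoint.infty := by
        intro z hz
        by_contra hne
        obtain ⟨i, hi⟩ := OnePoint.ne_infty_iff_exists.1 hne
        apply hz.2
        by_cases hzC : q z ∈ C i
        · exact Or.inl ⟨hz.1, Or.inr (mem_iUnion.2 ⟨i, hi.symm,
            (hOC i _ (hqp z i hi.symm)).2 hzC⟩)⟩
        · exact Or.inr ⟨hz.1, mem_iUnion.2 ⟨i, hi.symm, hzC⟩⟩
      have := isCompact_iff_compactSpace.1 hcl.isCompact
      refine Or.inr ⟨a, haγ, hX.of_isClosedEmbedding _ (fun z => q z.1)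
        (Continuous.isClosedEmbedding (hq.comp continuous_subtype_val) ?_)⟩
      intro z w hzw
      apply Subtype.ext
      rw [← hjq _ (hinf z.1 z.2), ← hjq _ (hinf w.1 w.2)]
      exact congrArg j hzw
  have := (LGood.biUnion (fun i : ι => p ⁻¹' {(i : OnePoint ι)}) Φ (fun i _ => hHc i)
    (fun i _ => hH i)).union hΦc hRc hgoodR
  rwa [hR, union_compl_self] at this

theorem LInd_eq_of_ne_top {L : Type} [TopologicalSpace L] {X : Type} [TopologicalSpace X]
    [Nonempty X] (h : LInd L X ≠ ⊤) :
    ∃ a : Ordinal.{0}, LInd L X = Dim.ofOrdinal a ∧ LIndLE L X a := by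
  have hne : ¬ IsEmpty X := not_isEmpty_iff.2 inferInstance
  unfold LInd at *
  rw [if_neg hne] at *
  split_ifs at h ⊢ with h1
  · exact ⟨_, rfl, csInf_mem (s := {α | LIndLE L X α}) h1⟩
  · exact absurd rfl h

theorem LInd_le {L : Type} [TopologicalSpace L] {X : Type} [TopologicalSpace X]
    {a : Ordinal.{0}} (h : LIndLE L X a) : LInd L X ≤ Dim.ofOrdinal a := by
  unfold LInd
  split_ifs with h1 h2
  · exact WithTop.coe_le_coe.2 bot_le
  · exact WithTop.coe_le_coe.2 (WithBot.coe_le_coe.2 (csInf_le' h))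
  · exact absurd ⟨a, h⟩ h2

-- STATEMENT 10
theorem statement10 (L : Type) [MetricSpace L] [CompactSpace L]
    (hANR : IsANR L) (hL : ¬ContractibleSpace L)
    (X Y : Type) [TopologicalSpace X] [TopologicalSpace Y]
    [CompactSpace X] [CompactSpace Y] [T2Space X] [T2Space Y] [Nonempty X] [Nonempty Y]
    (ι : Type) [TopologicalSpace ι] [DiscreteTopology ι]
    (hι : ZCardOK X Y ι) (φ : ι → Set X) (hφ : ZPhiOK φ) :
    LInd L (ZSpace ι X Y φ) ≤ max (LInd L X + 1) (LInd L Y) := by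
  by_cases hXt : LInd L X = ⊤
  · rw [hXt]
    simp
  by_cases hYt : LInd L Y = ⊤
  · rw [hYt]
    simp
  obtain ⟨a, ha, hXa⟩ := LInd_eq_of_ne_top hXt
  obtain ⟨b, hb, hYb⟩ := LInd_eq_of_ne_top hYt
  have : Nonempty L := nonempty_of_LIndLE L a X hXa
  have hmain := LInd_le (LIndLE_Z hANR φ hφ.1 hXa hYb
    (lt_max_of_lt_left (Order.lt_add_one_iff.2 le_rfl) : a < max (a + 1) b) (le_max_right _ _))
  rw [ha, hb]
  refine hmain.trans ?_
  rcases le_total (a + 1) b with h | h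
  · rw [max_eq_right h]
    exact le_max_right _ _
  · rw [max_eq_left h]
    exact le_max_left _ _

end
end

section
/- Let L be a non-contractible compact metric ANR, and X, Y non-empty compact spaces with X Fréchet. If L-Ind X = L-Ind Y and L-Ind K(X) ≥ 1, where K(X) = { b ∈ X : L-Ind_{b+} X = L-Ind X }, then L-Ind Z(X,Y) = L-Ind X + 1. -/
open Set Topology Cardinal

noncomputable section

attribute [local instance] Classical.propDecidable

/-! ### Basic facts on `L-Ind` -/

theorem lindLE_iff (L : Type) [TopologicalSpace L] (X : Type) [TopologicalSpace X]
    (α : Ordinal.{0}) : LIndLE L X α ↔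
    ∀ F : Set X, IsClosed F → ∀ f : C(F, L),
      ∃ U : Set X, IsOpen U ∧ ∃ hFU : F ⊆ U,
        (∃ g : C(U, L), ∀ (x : X) (hx : x ∈ F), g ⟨x, hFU hx⟩ = f ⟨x, hx⟩) ∧
        (Uᶜ = (∅ : Set X) ∨ ∃ β < α, LIndLE L (↥(Uᶜ)) β) := by
  unfold LIndLE LIndLeAux
  rw [WellFounded.fix_eq]
  simp only [Subtype.exists, Set.mem_Iio, exists_prop]

theorem lindLE_mono_ord {L : Type} [TopologicalSpace L] {X : Type} [TopologicalSpace X]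
    {α β : Ordinal.{0}} (h : α ≤ β) (hX : LIndLE L X α) : LIndLE L X β := by
  rw [lindLE_iff] at hX ⊢
  intro F hF f
  obtain ⟨U, hU, hFU, hg, h'⟩ := hX F hF f
  refine ⟨U, hU, hFU, hg, ?_⟩
  rcases h' with h' | ⟨γ, hγ, h'⟩
  · exact Or.inl h'
  · exact Or.inr ⟨γ, hγ.trans_le h, h'⟩

theorem lindLE_of_isEmpty {L : Type} [TopologicalSpace L] {X : Type} [TopologicalSpace X]
    [IsEmpty X] (α : Ordinal.{0}) : LIndLE L X α := by
  rw [lindLE_iff]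
  intro F hF f
  refine ⟨∅, isOpen_empty, fun x => isEmptyElim x, ⟨⟨fun x => isEmptyElim x.1,
    continuous_of_const fun x => isEmptyElim x.1⟩, fun x => isEmptyElim x⟩, Or.inl ?_⟩
  exact Set.eq_empty_of_isEmpty _

theorem lindLE_of_closedEmbedding {L : Type} [TopologicalSpace L] (α : Ordinal.{0}) :
    ∀ {X X' : Type} [TopologicalSpace X] [TopologicalSpace X'] (e : X' → X),
      IsClosedEmbedding e → LIndLE L X α → LIndLE L X' α := by
  induction α using WellFoundedLT.induction with
  | ind α ih =>
  intro X X' _ _ e he hX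
  rw [lindLE_iff] at hX ⊢
  intro F' hF' f'
  let hh := he.isEmbedding.homeomorphImage F'
  obtain ⟨U, hU, hFU, ⟨g, hg⟩, h'⟩ := hX (e '' F') (he.isClosedMap _ hF')
    (f'.comp ⟨hh.symm, hh.symm.continuous⟩)
  refine ⟨e ⁻¹' U, hU.preimage he.continuous, Set.image_subset_iff.1 hFU,
    ⟨g.comp ⟨U.restrictPreimage e, he.continuous.restrictPreimage⟩, ?_⟩, ?_⟩
  · intro x hx
    have := hg (e x) (Set.mem_image_of_mem e hx)
    simp only [ContinuousMap.comp_apply, ContinuousMap.coe_mk] at this ⊢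
    refine Eq.trans this ?_
    congr 1
    exact hh.symm_apply_apply ⟨x, hx⟩
  · rcases h' with h' | ⟨β, hβ, h'⟩
    · left
      rw [← Set.preimage_compl, h', Set.preimage_empty]
    · right
      exact ⟨β, hβ, ih β hβ (Set.restrictPreimage Uᶜ e) (he.restrictPreimage Uᶜ) h'⟩

theorem lindLE_subset {L : Type} [TopologicalSpace L] {C : Type} [TopologicalSpace C]
    {A B : Set C} (hAB : A ⊆ B) (hA : IsClosed A) {α : Ordinal.{0}} (h : LIndLE L B α) :
    LIndLE L A α :=
  lindLE_of_closedEmbedding α (Set.inclusion hAB)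
    ⟨Topology.IsEmbedding.inclusion hAB, by
      rw [Set.range_inclusion]; exact hA.preimage continuous_subtype_val⟩ h

/-- `T` is a partition in `A` of the partial map `f` on `F`, of dimension `< α`. -/
def HasPart (L : Type) [TopologicalSpace L] {C : Type} [TopologicalSpace C]
    (A F : Set C) (f : C → L) (α : Ordinal.{0}) : Prop :=
  ∃ T : Set C, IsClosed T ∧ T ⊆ A ∧ Disjoint F T ∧ ∃ g : C → L,
    ContinuousOn g (A \ T) ∧ EqOn g f F ∧ (T = ∅ ∨ ∃ β < α, LIndLE L T β)

theorem lindLE_set_iff {L : Type} [TopologicalSpace L] [Nonempty L]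
    {C : Type} [TopologicalSpace C] {A : Set C} (hA : IsClosed A) (α : Ordinal.{0}) :
    LIndLE L A α ↔ ∀ F ⊆ A, IsClosed F → ∀ f : C → L, ContinuousOn f F → HasPart L A F f α := by
  rw [lindLE_iff]
  constructor
  · intro h F hFA hF f hf
    obtain ⟨U, hU, hFU, ⟨g, hg⟩, h'⟩ := h (Subtype.val ⁻¹' F)
      (hF.preimage continuous_subtype_val)
      ⟨fun x => f x.1.1, hf.comp_continuous (by fun_prop) (fun x => x.2)⟩
    have hcl : IsClosed (Subtype.val '' Uᶜ) :=
      hA.isClosedEmbedding_subtypeVal.isClosedMap _ hU.isClosed_compl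
    refine ⟨Subtype.val '' Uᶜ, hcl, by simp, ?_,
      fun x => if hx : ∃ hA : x ∈ A, (⟨x, hA⟩ : A) ∈ U then g ⟨⟨x, hx.1⟩, hx.2⟩
        else Classical.arbitrary L, ?_, ?_, ?_⟩
    · rw [Set.disjoint_left]
      rintro x hxF ⟨y, hyU, rfl⟩
      exact hyU (hFU hxF)
    · rw [continuousOn_iff_continuous_domRestrict]
      have hm : ∀ x : ↥(A \ Subtype.val '' Uᶜ), ∃ hA : x.1 ∈ A, (⟨x, hA⟩ : A) ∈ U := by
        rintro ⟨x, hxA, hx⟩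
        refine ⟨hxA, ?_⟩
        by_contra hcon
        exact hx ⟨⟨x, hxA⟩, hcon, rfl⟩
      have : Continuous fun x : ↥(A \ Subtype.val '' Uᶜ) =>
          g ⟨⟨x.1, (hm x).1⟩, (hm x).2⟩ := by
        apply g.continuous.comp
        fun_prop
      convert this using 1
      ext x
      simp only [Set.domRestrict_apply]
      rw [dif_pos (hm x)]
    · intro x hx
      have hx2 : ∃ hA : x ∈ A, (⟨x, hA⟩ : A) ∈ U := ⟨hFA hx, hFU (by exact hx)⟩
      simp only
      rw [dif_pos hx2]
      exact hg ⟨x, hFA hx⟩ hx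
    · rcases h' with h' | ⟨β, hβ, h'⟩
      · left; rw [h', Set.image_empty]
      · right
        refine ⟨β, hβ, lindLE_of_closedEmbedding β
          (Topology.IsEmbedding.subtypeVal.homeomorphImage Uᶜ).symm
          (Homeomorph.isClosedEmbedding _) h'⟩
  · intro h F hF f
    obtain ⟨T, hT, hTA, hFT, g, hg, hgf, h'⟩ := h (Subtype.val '' F) (by simp)
      (hA.isClosedEmbedding_subtypeVal.isClosedMap _ hF)
      (fun x => if hx : ∃ hA : x ∈ A, (⟨x, hA⟩ : A) ∈ F then f ⟨⟨x, hx.1⟩, hx.2⟩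
        else Classical.arbitrary L) (by
        rw [continuousOn_iff_continuous_domRestrict]
        have hm : ∀ x : ↥(Subtype.val '' F), ∃ hA : x.1 ∈ A, (⟨x, hA⟩ : A) ∈ F := by
          rintro ⟨x, y, hy, rfl⟩
          exact ⟨y.2, hy⟩
        have : Continuous fun x : ↥(Subtype.val '' F) =>
            f ⟨⟨x.1, (hm x).1⟩, (hm x).2⟩ := by
          apply f.continuous.comp
          fun_prop
        convert this using 1
        ext x
        simp only [Set.domRestrict_apply]
        rw [dif_pos (hm x)])
    refine ⟨(Subtype.val ⁻¹' T)ᶜ, (hT.preimage continuous_subtype_val).isOpen_compl, ?_, ?_, ?_⟩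
    · intro x hx hxT
      exact Set.disjoint_left.1 hFT ⟨x, hx, rfl⟩ hxT
    · refine ⟨⟨fun x => g x.1.1, hg.comp_continuous (by fun_prop) (fun x => ⟨x.1.2, x.2⟩)⟩, ?_⟩
      intro x hx
      have := hgf ⟨x, hx, rfl⟩
      simp only at this
      rw [dif_pos ⟨x.2, hx⟩] at this
      exact this
    · rw [compl_compl]
      rcases h' with h' | ⟨β, hβ, h'⟩
      · left; rw [h', Set.preimage_empty]
      · right
        refine ⟨β, hβ, lindLE_of_closedEmbedding β
          (fun x : ↥(Subtype.val ⁻¹' T : Set A) => (⟨x.1.1, x.2⟩ : T)) ?_ h'⟩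
        have hemb : Topology.IsEmbedding
            (fun x : ↥(Subtype.val ⁻¹' T : Set A) => (x.1.1 : C)) :=
          Topology.IsEmbedding.subtypeVal.comp Topology.IsEmbedding.subtypeVal
        refine ⟨Topology.IsEmbedding.of_comp (by fun_prop) continuous_subtype_val hemb, ?_⟩
        · convert isClosed_univ
          ext ⟨x, hx⟩
          simp only [Set.mem_range, Set.mem_univ, iff_true]
          exact ⟨⟨⟨x, hTA hx⟩, hx⟩, rfl⟩

theorem lindLE_univ {L : Type} [TopologicalSpace L] {C : Type} [TopologicalSpace C]
    (α : Ordinal.{0}) : LIndLE L (univ : Set C) α ↔ LIndLE L C α :=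
  ⟨lindLE_of_closedEmbedding α (Homeomorph.Set.univ C).symm (Homeomorph.isClosedEmbedding _),
   lindLE_of_closedEmbedding α (Homeomorph.Set.univ C) (Homeomorph.isClosedEmbedding _)⟩

theorem continuousOn_disj {C L : Type} [TopologicalSpace C] [TopologicalSpace L]
    {A B A' B' : Set C} (hA : IsClosed A) (hB : IsClosed B) (hAB : Disjoint A B)
    (hA' : A' ⊆ A) (hB' : B' ⊆ B) {g k : C → L} (hg : ContinuousOn g A')
    (hk : ContinuousOn k B') :
    ContinuousOn (fun x => if x ∈ A then g x else k x) (A' ∪ B') := by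
  rintro x (hx | hx)
  · have hxB : Bᶜ ∈ 𝓝 x := hB.isOpen_compl.mem_nhds (Set.disjoint_left.1 hAB (hA' hx))
    have h1 : ContinuousWithinAt (fun x => if x ∈ A then g x else k x) A' x :=
      (hg x hx).congr (fun y hy => if_pos (hA' hy)) (if_pos (hA' hx))
    refine (h1.mono_of_mem_nhdsWithin ?_)
    filter_upwards [self_mem_nhdsWithin, mem_nhdsWithin_of_mem_nhds hxB] with y hy hyB
    exact hy.resolve_right fun h => hyB (hB' h)
  · have hxA : Aᶜ ∈ 𝓝 x := hA.isOpen_compl.mem_nhds (Set.disjoint_right.1 hAB (hB' hx))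
    have h1 : ContinuousWithinAt (fun x => if x ∈ A then g x else k x) B' x :=
      (hk x hx).congr (fun y hy => if_neg (Set.disjoint_right.1 hAB (hB' hy)))
        (if_neg (Set.disjoint_right.1 hAB (hB' hx)))
    refine (h1.mono_of_mem_nhdsWithin ?_)
    filter_upwards [self_mem_nhdsWithin, mem_nhdsWithin_of_mem_nhds hxA] with y hy hyA
    exact hy.resolve_left fun h => hyA (hA' h)

/-- Gluing of partitions over a disjoint union of closed sets, given the sum theorem below. -/
theorem hasPart_union_aux {L : Type} [TopologicalSpace L] [Nonempty L]
    {C : Type} [TopologicalSpace C] (α : Ordinal.{0})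
    (ih : ∀ β < α, ∀ S T : Set C, IsClosed S → IsClosed T → Disjoint S T →
      LIndLE L S β → LIndLE L T β → LIndLE L ↥(S ∪ T) β)
    {A B F : Set C} (hA : IsClosed A) (hB : IsClosed B) (hAB : Disjoint A B) {f : C → L}
    (hF : F ⊆ A ∪ B)
    (h1 : HasPart L A (F ∩ A) f α) (h2 : HasPart L B (F ∩ B) f α) :
    HasPart L (A ∪ B) F f α := by
  obtain ⟨S, hS, hSA, hFS, g, hg, hgf, hSα⟩ := h1
  obtain ⟨T, hT, hTB, hFT, k, hk, hkf, hTα⟩ := h2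
  refine ⟨S ∪ T, hS.union hT, Set.union_subset_union hSA hTB, ?_,
    fun x => if x ∈ A then g x else k x, ?_, ?_, ?_⟩
  · rw [Set.disjoint_left] at *
    rintro x hxF (hx | hx)
    · exact hFS ⟨hxF, hSA hx⟩ hx
    · exact hFT ⟨hxF, hTB hx⟩ hx
  · refine (continuousOn_disj hA hB hAB Set.sdiff_subset Set.sdiff_subset hg hk).mono ?_
    rintro x ⟨hx | hx, hx'⟩
    · exact Or.inl ⟨hx, fun h => hx' (Or.inl h)⟩
    · exact Or.inr ⟨hx, fun h => hx' (Or.inr h)⟩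
  · intro x hx
    by_cases hxA : x ∈ A
    · simp only [if_pos hxA]; exact hgf ⟨hx, hxA⟩
    · simp only [if_neg hxA]; exact hkf ⟨hx, (hF hx).resolve_left hxA⟩
  · rcases hSα with rfl | ⟨β, hβ, hSβ⟩
    · rw [Set.empty_union]; exact hTα
    · rcases hTα with rfl | ⟨γ, hγ, hTγ⟩
      · rw [Set.union_empty]; exact Or.inr ⟨β, hβ, hSβ⟩
      · right
        refine ⟨max β γ, max_lt hβ hγ, ih _ (max_lt hβ hγ) S T hS hT
          (hAB.mono hSA hTB) (lindLE_mono_ord (le_max_left _ _) hSβ)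
          (lindLE_mono_ord (le_max_right _ _) hTγ)⟩

theorem lindLE_union {L : Type} [TopologicalSpace L] [Nonempty L]
    {C : Type} [TopologicalSpace C] (α : Ordinal.{0}) :
    ∀ A B : Set C, IsClosed A → IsClosed B → Disjoint A B →
      LIndLE L A α → LIndLE L B α → LIndLE L ↥(A ∪ B) α := by
  induction α using WellFoundedLT.induction with
  | ind α ih =>
  intro A B hA hB hAB h1 h2
  rw [lindLE_set_iff hA] at h1
  rw [lindLE_set_iff hB] at h2
  rw [lindLE_set_iff (hA.union hB)]
  intro F hFs hF f hf
  exact hasPart_union_aux α ih hA hB hAB hFs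
    (h1 _ Set.inter_subset_right (hF.inter hA) f (hf.mono Set.inter_subset_left))
    (h2 _ Set.inter_subset_right (hF.inter hB) f (hf.mono Set.inter_subset_left))

theorem hasPart_union {L : Type} [TopologicalSpace L] [Nonempty L]
    {C : Type} [TopologicalSpace C] (α : Ordinal.{0})
    {A B F : Set C} (hA : IsClosed A) (hB : IsClosed B) (hAB : Disjoint A B) {f : C → L}
    (hF : F ⊆ A ∪ B)
    (h1 : HasPart L A (F ∩ A) f α) (h2 : HasPart L B (F ∩ B) f α) :
    HasPart L (A ∪ B) F f α :=
  hasPart_union_aux α (fun β _ => lindLE_union β) hA hB hAB hF h1 h2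

theorem hasPart_subset {L : Type} [TopologicalSpace L]
    {C : Type} [TopologicalSpace C] {α : Ordinal.{0}}
    {A B F : Set C} (hA : IsClosed A) (hAB : A ⊆ B) {f : C → L}
    (h : HasPart L B F f α) : HasPart L A (F ∩ A) f α := by
  obtain ⟨T, hT, hTA, hFT, g, hg, hgf, h'⟩ := h
  refine ⟨T ∩ A, hT.inter hA, Set.inter_subset_right,
    hFT.mono Set.inter_subset_left Set.inter_subset_left, g, hg.mono ?_,
    hgf.mono Set.inter_subset_left, ?_⟩
  · rintro x ⟨hx, hx'⟩
    exact ⟨hAB hx, fun h => hx' ⟨h, hx⟩⟩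
  · rcases h' with rfl | ⟨β, hβ, h'⟩
    · left; simp
    · exact Or.inr ⟨β, hβ, lindLE_subset Set.inter_subset_left (hT.inter hA) h'⟩

/-! ### Tools for ANRs -/

/-- A neighbourhood retraction of `ℝ^ℕ` onto a copy of `L`. -/
structure ANRData (L : Type) [TopologicalSpace L] where
  e : L → (ℕ → ℝ)
  O : Set (ℕ → ℝ)
  r : (ℕ → ℝ) → L
  cont_e : Continuous e
  open_O : IsOpen O
  mem_O : ∀ a, e a ∈ O
  cont_r : ContinuousOn r O
  r_e : ∀ a, r (e a) = a

theorem exists_anrData (L : Type) [MetricSpace L] [CompactSpace L] [Nonempty L]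
    (h : IsANR L) : Nonempty (ANRData L) := by
  let e : L → (ℕ → ℝ) := fun x n => dist x (TopologicalSpace.denseSeq L n)
  have he : Continuous e := by fun_prop
  have hinj : Function.Injective e := by
    intro x y hxy
    have h1 : (fun z => dist x z) = fun z => dist y z := by
      apply Continuous.ext_on (TopologicalSpace.denseRange_denseSeq L) (by fun_prop) (by fun_prop)
      rintro _ ⟨n, rfl⟩
      exact congrFun hxy n
    have := congrFun h1 y
    simpa using this
  have hemb : IsClosedEmbedding e := he.isClosedEmbedding hinj
  let : MetricSpace (ℕ → ℝ) := TopologicalSpace.metrizableSpaceMetric (ℕ → ℝ)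
  obtain ⟨U, hU, hAU, r, hr⟩ := h.2 (ℕ → ℝ) (Set.range e) hemb.isClosed_range
    hemb.isEmbedding.toHomeomorph.symm
  refine ⟨⟨e, U, fun x => if hx : x ∈ U then r ⟨x, hx⟩ else Classical.arbitrary L, he, hU,
    fun a => hAU ⟨a, rfl⟩, ?_, ?_⟩⟩
  · rw [continuousOn_iff_continuous_domRestrict]
    convert r.continuous using 1
    ext x
    simp only [Set.domRestrict_apply]
    rw [dif_pos x.2]
  · intro a
    rw [dif_pos (hAU ⟨a, rfl⟩), hr (e a) ⟨a, rfl⟩]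
    exact hemb.isEmbedding.toHomeomorph.symm_apply_apply a

section Tools

variable {L : Type} [TopologicalSpace L]

theorem ANRData.tietze (d : ANRData L) {C : Type} [TopologicalSpace C] [NormalSpace C]
    {F : Set C} (hF : IsClosed F) {f : C → L} (hf : ContinuousOn f F) :
    ∃ G : C → (ℕ → ℝ), Continuous G ∧ ∀ x ∈ F, G x = d.e (f x) := by
  obtain ⟨G, hG⟩ := ContinuousMap.exists_restrict_eq hF
    (⟨fun x : F => d.e (f x), d.cont_e.comp hf.domRestrict⟩ : C(F, ℕ → ℝ))
  refine ⟨G, G.continuous, fun x hx => ?_⟩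
  have := DFunLike.congr_fun hG ⟨x, hx⟩
  simpa using this

theorem ANRData.extNbhd (d : ANRData L) {C : Type} [TopologicalSpace C] [NormalSpace C]
    {F : Set C} (hF : IsClosed F) {f : C → L} (hf : ContinuousOn f F) :
    ∃ V : Set C, IsOpen V ∧ F ⊆ V ∧ ∃ g : C → L, ContinuousOn g V ∧ EqOn g f F := by
  obtain ⟨G, hG, hGf⟩ := d.tietze hF hf
  refine ⟨G ⁻¹' d.O, d.open_O.preimage hG, fun x hx => ?_, fun x => d.r (G x),
    d.cont_r.comp hG.continuousOn (fun x hx => hx), fun x hx => ?_⟩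
  · rw [Set.mem_preimage, hGf x hx]; exact d.mem_O _
  · simp only [hGf x hx, d.r_e]

/-- The convex combination used for patching. -/
def comb (t : ℝ) (a b : ℕ → ℝ) : ℕ → ℝ := (1 - t) • a + t • b

theorem comb_self (t : ℝ) (a : ℕ → ℝ) : comb t a a = a := by
  unfold comb; rw [← add_smul]; simp

theorem comb_zero (a b : ℕ → ℝ) : comb 0 a b = a := by simp [comb]

theorem comb_one (a b : ℕ → ℝ) : comb 1 a b = b := by simp [comb]

theorem ANRData.setup (d : ANRData L) {C : Type} [TopologicalSpace C] [NormalSpace C]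
    {F : Set C} (hF : IsClosed F) {f : C → L} (hf : ContinuousOn f F) :
    ∃ (D₁ D : Set C) (f' : C → L) (G : C → (ℕ → ℝ)) (t : C → ℝ),
      IsClosed D₁ ∧ IsClosed D ∧ F ⊆ interior D₁ ∧ D₁ ⊆ interior D ∧ ContinuousOn f' D ∧
      EqOn f' f F ∧ Continuous G ∧ (∀ x ∈ D, G x = d.e (f' x)) ∧ Continuous t ∧
      (∀ x ∈ F, t x = 1) ∧ (∀ x ∉ D₁, t x = 0) := by
  obtain ⟨V, hV, hFV, f', hf', hff⟩ := d.extNbhd hF hf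
  obtain ⟨V', hV', hFV', hVV'⟩ := normal_exists_closure_subset hF hV hFV
  obtain ⟨V₁, hV₁, hFV₁, hVV₁⟩ := normal_exists_closure_subset hF hV' hFV'
  have hf'' : ContinuousOn f' (closure V') := hf'.mono hVV'
  obtain ⟨G, hG, hGf⟩ := d.tietze isClosed_closure hf''
  obtain ⟨t, ht0, ht1, -⟩ := exists_continuous_zero_one_of_isClosed
    (s := V₁ᶜ) (t := F) hV₁.isClosed_compl hF
    (Set.disjoint_left.2 fun x hx hx' => hx (hFV₁ hx'))
  refine ⟨closure V₁, closure V', f', G, t, isClosed_closure, isClosed_closure,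
    hFV₁.trans (interior_maximal subset_closure hV₁),
    hVV₁.trans (interior_maximal subset_closure hV'), hf'', hff, hG, hGf, t.continuous,
    fun x hx => ht1 hx, fun x hx => ht0 fun h => hx (subset_closure h)⟩

theorem ANRData.cont_patch (d : ANRData L) {C : Type} [TopologicalSpace C] {W : Set C}
    {q : C → L} {G : C → (ℕ → ℝ)} {t : C → ℝ} (hq : ContinuousOn q W) (hG : Continuous G)
    (ht : Continuous t) (hW : ∀ z ∈ W, comb (t z) (d.e (q z)) (G z) ∈ d.O) :
    ContinuousOn (fun z => d.r (comb (t z) (d.e (q z)) (G z))) W := by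
  have h1 : ContinuousOn (fun z => d.e (q z)) W := d.cont_e.comp_continuousOn hq
  refine d.cont_r.comp ?_ hW
  unfold comb
  exact ((continuous_const.sub ht).continuousOn.smul h1).add
    (ht.continuousOn.smul hG.continuousOn)

theorem ANRData.cont_comb (d : ANRData L) {C : Type} [TopologicalSpace C] {W : Set C}
    {q : C → L} {G : C → (ℕ → ℝ)} {t : C → ℝ} (hq : ContinuousOn q W) (hG : Continuous G)
    (ht : Continuous t) :
    ContinuousOn (fun z => comb (t z) (d.e (q z)) (G z)) W := by
  have h1 : ContinuousOn (fun z => d.e (q z)) W := d.cont_e.comp_continuousOn hq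
  unfold comb
  exact ((continuous_const.sub ht).continuousOn.smul h1).add
    (ht.continuousOn.smul hG.continuousOn)

theorem ANRData.ext_zero (d : ANRData L) [Nonempty L] {X : Type} [TopologicalSpace X]
    [CompactSpace X] [T2Space X] {S E : Set X} (hS : IsClosed S) [TotallyDisconnectedSpace S]
    (hE : IsClosed E) (hES : E ⊆ S) {g : X → L} (hg : ContinuousOn g E) :
    ∃ g' : X → L, ContinuousOn g' S ∧ EqOn g' g E := by
  obtain ⟨V, hV, hEV, k, hk, hkg⟩ := d.extNbhd hE hg
  have : CompactSpace S := isCompact_iff_compactSpace.1 hS.isCompact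
  obtain ⟨W, hW, hEW, hWV⟩ := exists_clopen_of_closed_subset_open
    (hE.preimage (continuous_subtype_val : Continuous (Subtype.val : S → X)))
    (hV.preimage continuous_subtype_val) (Set.preimage_mono hEV)
  have hc := hS.isClosedEmbedding_subtypeVal.isClosedMap
  have hd : Disjoint (Subtype.val '' W) (Subtype.val '' Wᶜ : Set X) := by
    rw [Set.disjoint_image_iff Subtype.val_injective]
    exact disjoint_compl_right
  have := continuousOn_disj (hc W hW.isClosed) (hc Wᶜ hW.compl.isClosed) hd
    subset_rfl subset_rfl (g := k) (k := fun _ => Classical.arbitrary L)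
    (hk.mono (Set.image_subset_iff.2 hWV)) continuousOn_const
  refine ⟨_, this.mono ?_, ?_⟩
  · intro x hx
    by_cases h : (⟨x, hx⟩ : S) ∈ W
    · exact Or.inl ⟨_, h, rfl⟩
    · exact Or.inr ⟨_, h, rfl⟩
  · intro x hx
    have : x ∈ (Subtype.val '' W : Set X) := ⟨⟨x, hES hx⟩, hEW hx, rfl⟩
    simp only [if_pos this]
    exact hkg hx

theorem lindLE_prod (d : ANRData L) [Nonempty L] {S : Type} [TopologicalSpace S] [CompactSpace S]
    [T2Space S] [TotallyDisconnectedSpace S] (α : Ordinal.{0}) :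
    ∀ (Y : Type) [TopologicalSpace Y] [CompactSpace Y] [T2Space Y],
      LIndLE L Y α → LIndLE L (S × Y) α := by
  induction α using WellFoundedLT.induction with
  | ind α ih =>
  intro Y _ _ _ hY
  rw [← lindLE_univ, lindLE_set_iff isClosed_univ] at hY ⊢
  intro F _ hF f hf
  obtain ⟨D₁, D, f', G, t, hD₁, hD, hFD, hDD, hf', hff, hG, hGf, ht, ht1, ht0⟩ := d.setup hF hf
  have key : ∀ s : S, ∃ W : Set S, IsClopen W ∧ s ∈ W ∧
      HasPart L (Prod.fst ⁻¹' W : Set (S × Y)) (F ∩ Prod.fst ⁻¹' W) f α := by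
    intro s
    have hcs : Continuous fun y : Y => (s, y) := by fun_prop
    obtain ⟨T, hT, -, hDT, g, hg, hgf, h'⟩ := hY ((fun y => (s, y)) ⁻¹' D) (subset_univ _)
      (hD.preimage hcs) (fun y => f' (s, y)) (hf'.comp hcs.continuousOn fun y hy => hy)
    have hg2 : ContinuousOn (fun z : S × Y => g z.2) (Prod.snd ⁻¹' Tᶜ) :=
      hg.comp continuous_snd.continuousOn fun z hz => ⟨trivial, hz⟩
    have hop : IsOpen (Prod.snd ⁻¹' Tᶜ ∩ (fun z : S × Y =>
        comb (t z) (d.e (g z.2)) (G z)) ⁻¹' d.O) :=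
      (d.cont_comb hg2 hG ht).isOpen_inter_preimage
        (hT.isOpen_compl.preimage continuous_snd) d.open_O
    obtain ⟨V, V', hV, hV', hsV, hYV, hVV⟩ := generalized_tube_lemma
      (isCompact_singleton (x := s)) (isCompact_univ (X := Y)) (hop.union hD.isOpen_compl) (by
        rintro ⟨s', y⟩ ⟨hs', -⟩
        obtain rfl : s' = s := hs'
        by_cases hy : (s', y) ∈ D
        · left
          refine ⟨Set.disjoint_left.1 hDT hy, ?_⟩
          have h1 : g y = f' (s', y) := hgf hy
          simp only [Set.mem_preimage, hGf _ hy, h1, comb_self]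
          exact d.mem_O _
        · exact Or.inr hy)
    obtain ⟨W, hW, hsW, hWV⟩ := compact_exists_isClopen_in_isOpen hV (hsV rfl)
    have hWO : ∀ z ∈ Prod.fst ⁻¹' W ∩ Prod.snd ⁻¹' Tᶜ, comb (t z) (d.e (g z.2)) (G z) ∈ d.O := by
      intro z hz
      rcases hVV (show z ∈ V ×ˢ V' from ⟨hWV hz.1, hYV trivial⟩) with h | h
      · exact h.2
      · rw [ht0 z fun h2 => h (interior_subset (hDD h2)), comb_zero]
        exact d.mem_O _
    refine ⟨W, hW, hsW, W ×ˢ T, hW.isClosed.prod hT, fun z hz => hz.1, ?_,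
      fun z => d.r (comb (t z) (d.e (g z.2)) (G z)), ?_, ?_, ?_⟩
    · rw [Set.disjoint_left]
      rintro z ⟨hzF, hzW⟩ ⟨-, hzT⟩
      rcases hVV (show z ∈ V ×ˢ V' from ⟨hWV hzW, hYV trivial⟩) with h | h
      · exact h.1 hzT
      · exact h (interior_subset (hDD (interior_subset (hFD hzF))))
    · refine (d.cont_patch (hg2.mono (Set.inter_subset_right (s := Prod.fst ⁻¹' W)))
        hG ht hWO).mono ?_
      rintro z ⟨hz, hz'⟩
      exact ⟨hz, fun h => hz' ⟨hz, h⟩⟩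
    · rintro z ⟨hzF, -⟩
      simp only [ht1 z hzF, comb_one]
      rw [hGf z (interior_subset (hDD (interior_subset (hFD hzF)))), d.r_e]
      exact hff hzF
    · rcases h' with rfl | ⟨β, hβ, h'⟩
      · left; simp
      · right
        have : CompactSpace T := isCompact_iff_compactSpace.1 hT.isCompact
        refine ⟨β, hβ, lindLE_of_closedEmbedding β
          (fun z : ↥(W ×ˢ T) => (z.1.1, (⟨z.1.2, z.2.2⟩ : T))) ?_ (ih β hβ T h')⟩
        have : CompactSpace ↥(W ×ˢ T) :=
          isCompact_iff_compactSpace.1 (hW.isClosed.prod hT).isCompact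
        refine Continuous.isClosedEmbedding (by fun_prop) ?_
        rintro ⟨⟨x, y⟩, _⟩ ⟨⟨x', y'⟩, _⟩ h
        simpa using h
  have main : ∃ W : Set S, Set.univ ⊆ W ∧ IsClopen W ∧
      HasPart L (Prod.fst ⁻¹' W : Set (S × Y)) (F ∩ Prod.fst ⁻¹' W) f α := by
    refine isCompact_univ.induction_on
      (p := fun s : Set S => ∃ W : Set S, s ⊆ W ∧ IsClopen W ∧
        HasPart L (Prod.fst ⁻¹' W : Set (S × Y)) (F ∩ Prod.fst ⁻¹' W) f α) ?_ ?_ ?_ ?_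
    · refine ⟨∅, subset_rfl, isClopen_empty, ∅, isClosed_empty, by simp, by simp,
        f, by simp, fun x hx => rfl, Or.inl rfl⟩
    · rintro s s' hs ⟨W, hW, h⟩
      exact ⟨W, hs.trans hW, h⟩
    · rintro s s' ⟨W, hsW, hW, h⟩ ⟨W', hsW', hW', h'⟩
      refine ⟨W ∪ W', Set.union_subset_union hsW hsW', hW.union hW', ?_⟩
      have hd : IsClopen (W' \ W) := hW'.diff hW
      have e1 : (Prod.fst ⁻¹' (W ∪ W') : Set (S × Y)) =
          Prod.fst ⁻¹' W ∪ Prod.fst ⁻¹' (W' \ W) := by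
        rw [← Set.preimage_union, Set.union_sdiff_self]
      rw [e1]
      refine hasPart_union α (hW.isClosed.preimage continuous_fst)
        (hd.isClosed.preimage continuous_fst) ?_ Set.inter_subset_right ?_ ?_
      · rw [Set.disjoint_left]
        rintro z hz ⟨_, hz'⟩
        exact hz' hz
      · convert h using 1
        ext z; simp only [Set.mem_inter_iff, Set.mem_union]; tauto
      · have := hasPart_subset (A := Prod.fst ⁻¹' (W' \ W)) (hd.isClosed.preimage continuous_fst)
          (Set.preimage_mono Set.sdiff_subset) h'
        convert this using 1
        ext z; simp only [Set.mem_inter_iff, Set.mem_union, Set.mem_preimage, Set.mem_sdiff]; tauto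
    · intro s _
      obtain ⟨W, hW, hs, h⟩ := key s
      exact ⟨W, mem_nhdsWithin_of_mem_nhds (hW.isOpen.mem_nhds hs), W, subset_rfl, hW, h⟩
  obtain ⟨W, hW, -, h⟩ := main
  obtain rfl : W = Set.univ := Set.univ_subset_iff.1 hW
  simpa using h

end Tools

/-! ### Abstract description of `Z(X,Y)` and the upper bound -/

/-- The features of `Z(X,Y)` used in the proof. -/
structure ZData (Z X Y ι : Type) [TopologicalSpace Z] [TopologicalSpace X] [TopologicalSpace Y]
    [TopologicalSpace ι] (φ : ι → Set X) where
  p : Z → OnePoint ι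
  q : Z → X
  j : X → Z
  k : ∀ i, (φ i) × Y → Z
  cont_p : Continuous p
  cont_q : Continuous q
  cont_j : Continuous j
  cont_k : ∀ i, Continuous (k i)
  k_inj : ∀ i, Function.Injective (k i)
  q_j : ∀ x, q (j x) = x
  p_j : ∀ x, p (j x) = OnePoint.infty
  q_k : ∀ i s, q (k i s) = s.1
  p_k : ∀ i s, p (k i s) = (i : OnePoint ι)
  eq_j : ∀ z, p z = OnePoint.infty → z = j (q z)
  eq_k : ∀ z (i : ι), p z = (i : OnePoint ι) → ∃ s, z = k i s

theorem onePoint_finite_of_isClosed {ι : Type} [TopologicalSpace ι] [DiscreteTopology ι]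
    {A : Set (OnePoint ι)} (hA : IsClosed A) (h : OnePoint.infty ∉ A) :
    {i : ι | (i : OnePoint ι) ∈ A}.Finite := by
  have h1 := (OnePoint.isOpen_iff_of_mem (s := Aᶜ) h).1 hA.isOpen_compl
  have h2 := h1.2
  rw [← Set.preimage_compl, compl_compl] at h2
  exact h2.finite_of_discrete

theorem onePoint_isOpen_singleton {ι : Type} [TopologicalSpace ι] [DiscreteTopology ι]
    (i : ι) : IsOpen ({(i : OnePoint ι)} : Set (OnePoint ι)) := by
  have := OnePoint.isOpenEmbedding_coe.isOpenMap {i} (isOpen_discrete _)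
  simpa using this

theorem SFam.isCompact {X : Type} [TopologicalSpace X] {S : Set X} (hS : S ∈ SFam X) :
    IsCompact S := by
  rcases hS with h | ⟨⟨h⟩⟩
  · exact h.isCompact
  · exact isCompact_iff_compactSpace.2 h.symm.compactSpace

theorem SFam.totallyDisconnected {X : Type} [TopologicalSpace X] [T2Space X] {S : Set X}
    (hS : S ∈ SFam X) : TotallyDisconnectedSpace S := by
  rcases hS with h | ⟨⟨h⟩⟩
  · have := h.to_subtype
    infer_instance
  · exact h.isEmbedding.isTotallyDisconnected_range.1 (isTotallyDisconnected_of_totallyDisconnectedSpace _)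

section Upper

variable {L : Type} [TopologicalSpace L] [Nonempty L]
  {Z X Y ι : Type} [TopologicalSpace Z] [TopologicalSpace X] [TopologicalSpace Y]
  [TopologicalSpace ι] [DiscreteTopology ι] {φ : ι → Set X}
  [CompactSpace Z] [T2Space Z] [CompactSpace X] [T2Space X] [CompactSpace Y] [T2Space Y]

theorem ZData.lindLE_j (D : ZData Z X Y ι φ) {α : Ordinal.{0}} (h : LIndLE L X α) :
    LIndLE L ↥(D.p ⁻¹' {OnePoint.infty}) α := by
  have hc : IsClosed (D.p ⁻¹' {OnePoint.infty}) := isClosed_singleton.preimage D.cont_p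
  have : CompactSpace ↥(D.p ⁻¹' {OnePoint.infty}) := isCompact_iff_compactSpace.1 hc.isCompact
  refine lindLE_of_closedEmbedding α (fun z => D.q z.1) ?_ h
  refine Continuous.isClosedEmbedding (D.cont_q.comp continuous_subtype_val) ?_
  rintro ⟨z, hz⟩ ⟨z', hz'⟩ h
  simp only [Subtype.mk.injEq] at h ⊢
  rw [D.eq_j z hz, D.eq_j z' hz', h]

theorem ZData.lindLE_k (D : ZData Z X Y ι φ) (d : ANRData L) (hφ : ∀ i, φ i ∈ SFam X)
    {α : Ordinal.{0}} (h : LIndLE L Y α) (i : ι) :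
    LIndLE L ↥(D.p ⁻¹' {(i : OnePoint ι)}) α := by
  have := isCompact_iff_compactSpace.1 (SFam.isCompact (hφ i))
  have := SFam.totallyDisconnected (hφ i)
  have h1 : LIndLE L (φ i × Y) α := lindLE_prod d α Y h
  have hc : IsClosedEmbedding (D.k i) := (D.cont_k i).isClosedEmbedding (D.k_inj i)
  have hr : D.p ⁻¹' {(i : OnePoint ι)} = Set.range (D.k i) := by
    ext z
    constructor
    · intro hz
      obtain ⟨s, rfl⟩ := D.eq_k z i hz
      exact ⟨s, rfl⟩
    · rintro ⟨s, rfl⟩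
      exact D.p_k i s
  rw [hr]
  exact lindLE_of_closedEmbedding α hc.isEmbedding.toHomeomorph.symm
    (Homeomorph.isClosedEmbedding _) h1

theorem ZData.lindLE_finite (D : ZData Z X Y ι φ) (d : ANRData L) (hφ : ∀ i, φ i ∈ SFam X)
    {α : Ordinal.{0}} (hX : LIndLE L X α) (hY : LIndLE L Y α) {J : Set ι} (hJ : J.Finite) :
    LIndLE L ↥(D.p ⁻¹' (insert OnePoint.infty ((fun i : ι => (i : OnePoint ι)) '' J))) α := by
  induction J, hJ using Set.Finite.induction_on with
  | empty =>
    rw [Set.image_empty, insert_empty_eq]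
    exact D.lindLE_j hX
  | @insert i J hi hJ ih =>
    rw [Set.image_insert_eq, Set.insert_comm, Set.insert_eq, Set.preimage_union]
    refine lindLE_union α _ _ (isClosed_singleton.preimage D.cont_p)
      (((hJ.image _).insert _).isClosed.preimage D.cont_p) ?_ (D.lindLE_k d hφ hY i) ih
    rw [Set.disjoint_left]
    rintro z (hz : D.p z = i) hz'
    rw [Set.mem_preimage, hz] at hz'
    rcases hz' with h | ⟨i', hi', h⟩
    · exact OnePoint.coe_ne_infty _ h
    · exact hi (OnePoint.coe_injective h ▸ hi')

theorem ZData.upper (D : ZData Z X Y ι φ) (d : ANRData L) (hφ : ∀ i, φ i ∈ SFam X)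
    {α : Ordinal.{0}} (hX : LIndLE L X α) (hY : LIndLE L Y α) : LIndLE L Z (α + 1) := by
  rw [← lindLE_univ, lindLE_set_iff isClosed_univ]
  intro F _ hF f hf
  obtain ⟨B₁, B, f', G, t, hB₁, hB, hFB, hBB, hf', hff, hG, hGf, ht, ht1, ht0⟩ := d.setup hF hf
  -- the trace of `B` on `X`
  set E : Set X := D.j ⁻¹' B with hE
  have hEc : IsClosed E := hB.preimage D.cont_j
  set I : Set X := D.j ⁻¹' interior B with hI
  have hIo : IsOpen I := isOpen_interior.preimage D.cont_j
  have hIE : I ⊆ E := Set.preimage_mono interior_subset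
  have hg : ContinuousOn (fun x => f' (D.j x)) E := hf'.comp D.cont_j.continuousOn fun x hx => hx
  have hext : ∀ i, ∃ g' : X → L, ContinuousOn g' (φ i) ∧
      EqOn g' (fun x => f' (D.j x)) (E ∩ φ i) := fun i => by
    have := SFam.totallyDisconnected (hφ i)
    have hcl := (SFam.isCompact (hφ i)).isClosed
    exact d.ext_zero hcl (hEc.inter hcl) Set.inter_subset_right (hg.mono Set.inter_subset_left)
  choose g hgc hge using hext
  have hqφ : ∀ z (i : ι), D.p z = (i : OnePoint ι) → D.q z ∈ φ i := by
    intro z i hz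
    obtain ⟨s, rfl⟩ := D.eq_k z i hz
    rw [D.q_k]
    exact s.1.2
  set q : Z → L := fun z => Option.elim (D.p z : Option ι) (f' (D.j (D.q z)))
    (fun i => g i (D.q z)) with hq
  have hq_infty : ∀ z, D.p z = OnePoint.infty → q z = f' (D.j (D.q z)) := by
    intro z hz; simp only [hq, hz]; rfl
  have hq_coe : ∀ z (i : ι), D.p z = i → q z = g i (D.q z) := by
    intro z i hz; simp only [hq, hz]; rfl
  have hq_E : ∀ z, D.q z ∈ E → q z = f' (D.j (D.q z)) := by
    intro z hz
    rcases hp : D.p z with _ | i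
    · exact hq_infty z hp
    · rw [hq_coe z i hp]
      exact hge i ⟨hz, hqφ z i hp⟩
  -- the open set on which `q` is continuous
  set R : Set Z := D.j '' Iᶜ with hR
  have hRc : IsClosed R := (hIo.isClosed_compl.isCompact.image D.cont_j).isClosed
  have hqc : ContinuousOn q Rᶜ := by
    intro z hz
    apply ContinuousAt.continuousWithinAt
    rcases hp : D.p z with _ | i
    · have hzI : D.q z ∈ I := by
        by_contra hcon
        exact hz ⟨D.q z, hcon, (D.eq_j z hp).symm⟩
      have hn : D.q ⁻¹' I ∈ 𝓝 z := (hIo.preimage D.cont_q).mem_nhds hzI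
      have h1 : ContinuousAt (fun z => f' (D.j (D.q z))) z :=
        ContinuousAt.comp (f := D.q) (g := fun x => f' (D.j x))
          (hg.continuousAt (Filter.mem_of_superset (hIo.mem_nhds hzI) hIE)) D.cont_q.continuousAt
      refine h1.congr ?_
      filter_upwards [hn] with w hw
      exact (hq_E w (hIE hw)).symm
    · have hn : D.p ⁻¹' {(i : OnePoint ι)} ∈ 𝓝 z :=
        ((onePoint_isOpen_singleton i).preimage D.cont_p).mem_nhds hp
      have h1 : ContinuousOn (fun z => g i (D.q z)) (D.p ⁻¹' {(i : OnePoint ι)}) :=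
        (hgc i).comp D.cont_q.continuousOn fun w hw => hqφ w i hw
      refine (h1.continuousAt hn).congr ?_
      filter_upwards [hn] with w hw
      exact (hq_coe w i hw).symm
  have hop : IsOpen (Rᶜ ∩ (fun z => comb (t z) (d.e (q z)) (G z)) ⁻¹' d.O) :=
    (d.cont_comb hqc hG ht).isOpen_inter_preimage hRc.isOpen_compl d.open_O
  set Ω : Set Z := (Rᶜ ∩ (fun z => comb (t z) (d.e (q z)) (G z)) ⁻¹' d.O) ∪ B₁ᶜ with hΩ
  have hΩo : IsOpen Ω := hop.union hB₁.isOpen_compl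
  have hΩμ : ∀ z, D.p z = OnePoint.infty → z ∈ Ω := by
    intro z hz
    by_cases hzB : z ∈ B₁
    · left
      have hzj := D.eq_j z hz
      have hzI : D.q z ∈ I := by
        rw [hI, Set.mem_preimage, ← hzj]
        exact hBB hzB
      refine ⟨?_, ?_⟩
      · rintro ⟨x, hx, rfl⟩
        rw [D.q_j] at hzI
        exact hx hzI
      · rw [Set.mem_preimage, hq_E z (hIE hzI), ← hzj,
          hGf z (interior_subset (hBB hzB)), comb_self]
        exact d.mem_O _
    · exact Or.inr hzB
  set J : Set ι := {i : ι | (i : OnePoint ι) ∈ D.p '' Ωᶜ} with hJ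
  have hJf : J.Finite := by
    apply onePoint_finite_of_isClosed
      (hΩo.isClosed_compl.isCompact.image D.cont_p).isClosed
    rintro ⟨z, hz, hz'⟩
    exact hz (hΩμ z hz')
  set M : Set Z := D.p ⁻¹' ((fun i : ι => (i : OnePoint ι)) '' J) with hM
  have hMc : IsClosed M := (hJf.image _).isClosed.preimage D.cont_p
  have hMo : IsOpen M :=
    (OnePoint.isOpenEmbedding_coe.isOpenMap J (isOpen_discrete _)).preimage D.cont_p
  have hΩM : ∀ z ∉ M, z ∈ Ω := by
    intro z hz
    by_contra hcon
    rcases hp : D.p z with _ | i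
    · exact hcon (hΩμ z hp)
    · exact hz ⟨i, ⟨z, hcon, hp⟩, hp.symm⟩
  have hFB' : F ⊆ interior B := hFB.trans (interior_subset.trans hBB)
  have hcombO : ∀ z ∈ Mᶜ ∩ Rᶜ, comb (t z) (d.e (q z)) (G z) ∈ d.O := by
    rintro z ⟨hzM, hzR⟩
    rcases hΩM z hzM with h | h
    · exact h.2
    · rw [ht0 z h, comb_zero]; exact d.mem_O _
  have hhc := d.cont_patch (hqc.mono (Set.inter_subset_right (s := Mᶜ))) hG ht hcombO
  have hTc : IsClosed (R ∪ (M \ interior B)) := hRc.union (hMc.sdiff isOpen_interior)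
  refine ⟨R ∪ (M \ interior B), hTc, Set.subset_univ _, ?_,
    fun z => if z ∈ M then f' z else d.r (comb (t z) (d.e (q z)) (G z)), ?_, ?_, Or.inr ?_⟩
  · rw [Set.disjoint_left]
    rintro z hzF (⟨x, hx, rfl⟩ | hz)
    · exact hx (hFB' hzF)
    · exact hz.2 (hFB' hzF)
  · refine (continuousOn_disj hMc hMo.isClosed_compl disjoint_compl_right
      (Set.inter_subset_left (t := interior B)) (Set.inter_subset_left (t := Rᶜ))
      (hf'.mono (Set.inter_subset_right.trans interior_subset)) hhc).mono ?_
    rintro z ⟨-, hz⟩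
    by_cases hzM : z ∈ M
    · left
      refine ⟨hzM, ?_⟩
      by_contra hcon
      exact hz (Or.inr ⟨hzM, hcon⟩)
    · exact Or.inr ⟨hzM, fun h => hz (Or.inl h)⟩
  · intro z hzF
    by_cases hzM : z ∈ M
    · simp only [if_pos hzM]; exact hff hzF
    · simp only [if_neg hzM, ht1 z hzF, comb_one]
      rw [hGf z (interior_subset (hFB' hzF)), d.r_e]
      exact hff hzF
  · refine ⟨α, Order.lt_add_one_iff.2 le_rfl, lindLE_subset ?_ hTc (D.lindLE_finite d hφ hX hY hJf)⟩
    rintro z (⟨x, -, rfl⟩ | hz)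
    · left; exact D.p_j x
    · right; exact hz.1

end Upper

/-! ### The lower bound -/

open Filter in
theorem sfam_of_seq {X : Type} [TopologicalSpace X] [T2Space X] (u : ℕ → X) (b : X)
    (hu : Tendsto u atTop (𝓝 b)) (hb : ∀ n, u n ≠ b) :
    insert b (range u) ∈ SFam X ∧ (range u).Infinite := by
  have hinf : (range u).Infinite := by
    intro hf
    have : b ∈ range u := hf.isClosed.mem_of_tendsto hu (Eventually.of_forall fun n => mem_range_self n)
    obtain ⟨n, hn⟩ := this
    exact hb n hn
  refine ⟨Or.inr ?_, hinf⟩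
  have := hinf.to_subtype
  have hc : (range u).Countable := countable_range u
  have := hc.to_subtype
  obtain ⟨e⟩ := nonempty_equiv_of_countable (α := ℕ) (β := range u)
  have hν : Tendsto (fun n => (e n : X)) atTop (𝓝 b) := by
    intro V hV
    have h1 : {n | u n ∉ V}.Finite := by
      have := hu hV
      rw [← Nat.cofinite_eq_atTop, Filter.mem_map, Filter.mem_cofinite] at this
      exact this
    rw [← Nat.cofinite_eq_atTop, Filter.mem_map, Filter.mem_cofinite]
    refine Set.Finite.subset ((h1.image u).preimage (f := fun n => (e n : X)) ?_) ?_
    · exact (Subtype.val_injective.comp e.injective).injOn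
    · intro n hn
      obtain ⟨m, hm⟩ := (e n).2
      refine ⟨m, ?_, hm⟩
      simp only [mem_setOf_eq, hm]
      exact hn
  let F : C(OnePoint ℕ, X) := OnePoint.continuousMapMkNat (fun n => (e n : X)) b hν
  have hF0 : F OnePoint.infty = b := rfl
  have hF1 : ∀ n : ℕ, F (n : OnePoint ℕ) = e n := fun n => rfl
  have hinj : Function.Injective F := by
    intro a c
    induction a using OnePoint.rec with
    | infty =>
      induction c using OnePoint.rec with
      | infty => simp
      | coe c =>
        rw [hF0, hF1]
        intro h
        obtain ⟨m, hm⟩ := (e c).2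
        exact absurd (hm.trans h.symm) (hb m)
    | coe a =>
      induction c using OnePoint.rec with
      | infty =>
        rw [hF0, hF1]
        intro h
        obtain ⟨m, hm⟩ := (e a).2
        exact absurd (hm.trans h) (hb m)
      | coe c =>
        rw [hF1, hF1]
        intro h
        rw [e.injective (Subtype.ext h)]
  have hr : range F = insert b (range u) := by
    ext x
    constructor
    · rintro ⟨a, rfl⟩
      induction a using OnePoint.rec with
      | infty => exact Or.inl rfl
      | coe a => exact Or.inr (e a).2
    · rintro (rfl | h)
      · exact ⟨_, hF0⟩
      · refine ⟨((e.symm ⟨x, h⟩ : ℕ) : OnePoint ℕ), ?_⟩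
        rw [hF1]; simp
  have hemb := (F.continuous.isClosedEmbedding hinj).isEmbedding
  exact ⟨((hemb.toHomeomorph).trans (Homeomorph.setCongr hr)).symm⟩

section Lower

variable {L : Type} [MetricSpace L] [CompactSpace L]
  {Z X Y ι : Type} [TopologicalSpace Z] [TopologicalSpace X] [TopologicalSpace Y]
  [TopologicalSpace ι] [DiscreteTopology ι] {φ : ι → Set X}
  [CompactSpace Z] [T2Space Z] [CompactSpace X] [T2Space X] [CompactSpace Y] [T2Space Y]

theorem ZData.finite_bad (D : ZData Z X Y ι φ) {W : Set Z} (hW : IsOpen W) (x : X)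
    (hx : D.j x ∈ W) : {i : ι | ∃ s : φ i × Y, (s.1 : X) = x ∧ D.k i s ∉ W}.Finite := by
  have hc : IsClosed (Wᶜ ∩ D.q ⁻¹' {x}) :=
    hW.isClosed_compl.inter (isClosed_singleton.preimage D.cont_q)
  have h1 : IsClosed (D.p '' (Wᶜ ∩ D.q ⁻¹' {x})) := (hc.isCompact.image D.cont_p).isClosed
  refine (onePoint_finite_of_isClosed h1 ?_).subset ?_
  · rintro ⟨z, ⟨hz1, hz2⟩, hz3⟩
    have := D.eq_j z hz3
    rw [show D.q z = x from hz2] at this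
    exact hz1 (this ▸ hx)
  · rintro i ⟨s, hs, hs'⟩
    exact ⟨D.k i s, ⟨hs', by simp [D.q_k, hs]⟩, D.p_k i s⟩

theorem ZData.countable_bad (D : ZData Z X Y ι φ) {P : Set Z} (hP : IsClosed P) {g : Z → L}
    (hg : ContinuousOn g Pᶜ) (x : X) (hx : D.j x ∉ P) :
    {i : ι | ∃ s : φ i × Y, (s.1 : X) = x ∧ ¬ (D.k i s ∉ P ∧ g (D.k i s) = g (D.j x))}.Countable := by
  have h : ∀ n : ℕ, {i : ι | ∃ s : φ i × Y, (s.1 : X) = x ∧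
      D.k i s ∉ Pᶜ ∩ g ⁻¹' (Metric.ball (g (D.j x)) (1 / ((n : ℝ) + 1)))}.Finite := by
    intro n
    refine D.finite_bad (hg.isOpen_inter_preimage hP.isOpen_compl Metric.isOpen_ball) x ⟨hx, ?_⟩
    exact Metric.mem_ball_self Nat.one_div_pos_of_nat
  refine (countable_iUnion fun n => (h n).countable).mono ?_
  rintro i ⟨s, hs, hs'⟩
  simp only [mem_iUnion, mem_setOf_eq]
  by_contra hcon
  push Not at hcon
  have h0 := fun n => hcon n s hs
  refine hs' ⟨(h0 0).1, ?_⟩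
  by_contra hne
  obtain ⟨n, hn⟩ := exists_nat_one_div_lt (dist_pos.2 hne)
  exact lt_asymm hn (h0 n).2

open Filter in
theorem ZData.exists_lim [FrechetUrysohnSpace X] (D : ZData Z X Y ι φ) (hφ : ZPhiOK φ)
    (hι : Infinite X → ℵ₀ < #ι) {P : Set Z} (hP : IsClosed P) {g : Z → L}
    (hg : ContinuousOn g Pᶜ) (hPY : ∀ e : Y → P, ¬ IsClosedEmbedding e) (b : X)
    (hb : b ∈ closure (D.j ⁻¹' P)ᶜ) :
    ∃ l, Tendsto (g ∘ D.j) (𝓝[(D.j ⁻¹' P)ᶜ] b) (𝓝 l) := by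
  by_cases hbA : D.j b ∈ P
  swap
  · refine ⟨g (D.j b), ?_⟩
    have h1 : ContinuousAt g (D.j b) := hg.continuousAt (hP.isOpen_compl.mem_nhds hbA)
    exact (h1.comp D.cont_j.continuousAt).tendsto.mono_left nhdsWithin_le_nhds
  have hne : (𝓝[(D.j ⁻¹' P)ᶜ] b).NeBot := mem_closure_iff_nhdsWithin_neBot.1 hb
  by_contra hcon
  push Not at hcon
  obtain ⟨l, hl⟩ := exists_clusterPt_of_compactSpace (map (g ∘ D.j) (𝓝[(D.j ⁻¹' P)ᶜ] b))
  have hex : ∃ l', MapClusterPt l' (𝓝[(D.j ⁻¹' P)ᶜ] b) (g ∘ D.j) ∧ l' ≠ l := by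
    by_contra h
    push Not at h
    exact hcon l (tendsto_nhds_of_unique_mapClusterPt h)
  obtain ⟨l', hl', hne'⟩ := hex
  have key : ∀ l, MapClusterPt l (𝓝[(D.j ⁻¹' P)ᶜ] b) (g ∘ D.j) → ∀ r > 0,
      ∃ a : ℕ → X, (∀ n, D.j (a n) ∉ P ∧ dist (g (D.j (a n))) l ≤ r) ∧ Tendsto a atTop (𝓝 b) := by
    intro l hl r hr
    have h1 := mapClusterPt_iff_frequently.1 hl _ (Metric.closedBall_mem_nhds l hr)
    rw [frequently_nhdsWithin_iff] at h1
    have h2 : b ∈ closure {x | (g ∘ D.j) x ∈ Metric.closedBall l r ∧ x ∈ (D.j ⁻¹' P)ᶜ} :=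
      mem_closure_iff_frequently.2 h1
    obtain ⟨a, ha, ha'⟩ := mem_closure_iff_seq_limit.1 h2
    exact ⟨a, fun n => ⟨(ha n).2, (ha n).1⟩, ha'⟩
  have hd : 0 < dist l' l := dist_pos.2 hne'
  obtain ⟨a, ha, ha'⟩ := key l hl (dist l' l / 3) (by positivity)
  obtain ⟨c, hc, hc'⟩ := key l' hl' (dist l' l / 3) (by positivity)
  let u : ℕ → X := fun n => if Even n then a (n / 2) else c (n / 2)
  have hhalf : Tendsto (fun n : ℕ => n / 2) atTop atTop :=
    Nat.tendsto_div_const_atTop (by norm_num)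
  have hu : Tendsto u atTop (𝓝 b) := by
    intro V hV
    have h1 := (ha'.comp hhalf) hV
    have h2 := (hc'.comp hhalf) hV
    rw [Filter.mem_map] at h1 h2 ⊢
    filter_upwards [h1, h2] with n h1 h2
    by_cases hn : Even n
    · simpa [u, hn] using h1
    · simpa [u, hn] using h2
  have huP : ∀ n, D.j (u n) ∉ P := by
    intro n
    by_cases hn : Even n
    · simpa [u, hn] using (ha _).1
    · simpa [u, hn] using (hc _).1
  have hub : ∀ n, u n ≠ b := fun n h => huP n (h ▸ hbA)
  obtain ⟨hS, hinf⟩ := sfam_of_seq u b hu hub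
  have hXinf : Infinite X := by
    by_contra h
    rw [not_infinite_iff_finite] at h
    exact hinf (Set.toFinite _)
  have hbad := countable_iUnion fun n => D.countable_bad hP hg (u n) (huP n)
  have hex : ∃ i ∈ φ ⁻¹' {insert b (range u)}, i ∉ ⋃ n, {i : ι | ∃ s : φ i × Y, (s.1 : X) = u n ∧
      ¬ (D.k i s ∉ P ∧ g (D.k i s) = g (D.j (u n)))} := by
    by_contra h
    have h3 : (φ ⁻¹' {insert b (range u)}).Countable :=
      hbad.mono fun i hi => by_contra fun h' => h ⟨i, hi, h'⟩
    have h4 := Cardinal.le_aleph0_iff_set_countable.2 h3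
    rw [hφ.2 _ hS] at h4
    exact absurd (hι hXinf) (not_lt.2 h4)
  obtain ⟨i, hi, hgood⟩ := hex
  have hi' : φ i = insert b (range u) := hi
  have hbi : b ∈ φ i := by rw [hi']; exact mem_insert _ _
  have hui : ∀ n, u n ∈ φ i := fun n => by rw [hi']; exact Or.inr ⟨n, rfl⟩
  have hgood' : ∀ n y, D.k i (⟨u n, hui n⟩, y) ∉ P ∧ g (D.k i (⟨u n, hui n⟩, y)) = g (D.j (u n)) := by
    intro n y
    by_contra h
    exact hgood (mem_iUnion.2 ⟨n, _, rfl, h⟩)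
  have hfib : ∀ y, D.k i (⟨b, hbi⟩, y) ∈ P := by
    intro y
    by_contra hy
    have h1 : ContinuousAt g (D.k i (⟨b, hbi⟩, y)) := hg.continuousAt (hP.isOpen_compl.mem_nhds hy)
    have h2 : Tendsto (fun n => D.k i (⟨u n, hui n⟩, y)) atTop (𝓝 (D.k i (⟨b, hbi⟩, y))) := by
      refine ((D.cont_k i).tendsto _).comp ?_
      refine Tendsto.prodMk_nhds ?_ tendsto_const_nhds
      exact tendsto_subtype_rng.2 hu
    have h3 : Tendsto (fun n => g (D.j (u n))) atTop (𝓝 (g (D.k i (⟨b, hbi⟩, y)))) := by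
      refine (h1.tendsto.comp h2).congr fun n => (hgood' n y).2
    have e2 : Tendsto (fun n : ℕ => 2 * n) atTop atTop :=
      tendsto_id.const_mul_atTop' (by norm_num)
    have e3 : Tendsto (fun n : ℕ => 2 * n + 1) atTop atTop :=
      tendsto_atTop_mono (fun n => Nat.le_succ _) e2
    have h4 := Metric.isClosed_closedBall.mem_of_tendsto (h3.comp e2)
      (s := Metric.closedBall l (dist l' l / 3)) (Eventually.of_forall fun n => by
        have : u (2 * n) = a n := by simp [u]
        simp only [Function.comp, this]
        exact (ha n).2)
    have h5 := Metric.isClosed_closedBall.mem_of_tendsto (h3.comp e3)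
      (s := Metric.closedBall l' (dist l' l / 3)) (Eventually.of_forall fun n => by
        have : u (2 * n + 1) = c n := by
          have : (2 * n + 1) / 2 = n := by omega
          simp [u, this]
        simp only [Function.comp, this]
        exact (hc n).2)
    rw [Metric.mem_closedBall] at h4 h5
    have h6 := dist_triangle_left l' l (g (D.k i (⟨b, hbi⟩, y)))
    linarith
  refine hPY (fun y => ⟨D.k i (⟨b, hbi⟩, y), hfib y⟩) ?_
  refine Continuous.isClosedEmbedding ?_ ?_
  · exact ((D.cont_k i).comp (by fun_prop)).subtype_mk _
  · intro y y' h
    have := D.k_inj i (congrArg Subtype.val h)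
    simpa using this

theorem ZData.lower [Nonempty L] [FrechetUrysohnSpace X] (D : ZData Z X Y ι φ) (hφ : ZPhiOK φ)
    (hι : Infinite X → ℵ₀ < #ι) {α : Ordinal.{0}} {K : Set X} (hKc : IsClosed K)
    (hK : ¬ LIndLE L K 0)
    (hKb : ∀ b ∈ K, ∀ U : Set X, IsOpen U → b ∈ U → ∀ β < α, ¬ LIndLE L (closure U) β)
    (hY : ∀ β < α, ¬ LIndLE L Y β) [Nonempty Y] : ¬ LIndLE L Z α := by
  intro hZ
  rw [lindLE_set_iff hKc 0] at hK
  apply hK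
  intro F₀ hF₀K hF₀ f₀ hf₀
  have hZ' := (lindLE_univ α).2 hZ
  rw [lindLE_set_iff isClosed_univ α] at hZ'
  have hcF : IsClosed (D.j '' F₀) := (hF₀.isCompact.image D.cont_j).isClosed
  obtain ⟨P, hP, -, hFP, g, hg, hgf, hPd⟩ := hZ' (D.j '' F₀) (subset_univ _) hcF (f₀ ∘ D.q) (by
    refine hf₀.comp D.cont_q.continuousOn ?_
    rintro _ ⟨x, hx, rfl⟩
    rw [D.q_j]; exact hx)
  rw [← compl_eq_univ_sdiff] at hg
  have hPY : ∀ e : Y → P, ¬ IsClosedEmbedding e := by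
    intro e he
    rcases hPd with h | ⟨β, hβ, h⟩
    · have y := Classical.arbitrary Y
      exact Set.eq_empty_iff_forall_notMem.1 h _ (e y).2
    · exact hY β hβ (lindLE_of_closedEmbedding β e he h)
  have hA : IsClosed (D.j ⁻¹' P) := hP.preimage D.cont_j
  have hKcl : K ⊆ closure (D.j ⁻¹' P)ᶜ := by
    intro b hb
    rw [closure_compl]
    intro hbi
    obtain ⟨C, hC, hCc, hCs⟩ := exists_mem_nhds_isClosed_subset (isOpen_interior.mem_nhds hbi)
    have hsub : closure (interior C) ⊆ D.j ⁻¹' P :=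
      (closure_minimal interior_subset hCc).trans (hCs.trans interior_subset)
    have hbC : b ∈ interior C := mem_interior_iff_mem_nhds.2 hC
    rcases hPd with h | ⟨β, hβ, h⟩
    · have h1 : D.j b ∈ P := hsub (subset_closure hbC)
      rw [h] at h1
      exact h1
    · refine hKb b hb (interior C) isOpen_interior hbC β hβ ?_
      have : CompactSpace ↥(closure (interior C)) := isCompact_iff_compactSpace.1 isClosed_closure.isCompact
      refine lindLE_of_closedEmbedding β (fun x => (⟨D.j x.1, hsub x.2⟩ : P)) ?_ h
      refine Continuous.isClosedEmbedding ((D.cont_j.comp continuous_subtype_val).subtype_mk _) ?_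
      intro x y hxy
      have := congrArg D.q (congrArg Subtype.val hxy)
      simp only [D.q_j] at this
      exact Subtype.ext this
  refine ⟨∅, isClosed_empty, empty_subset _, disjoint_empty _,
    extendFrom (D.j ⁻¹' P)ᶜ (g ∘ D.j), ?_, ?_, Or.inl rfl⟩
  · rw [Set.sdiff_empty]
    exact continuousOn_extendFrom hKcl fun b hb => D.exists_lim hφ hι hP hg hPY b (hKcl hb)
  · intro x hx
    have hx' : D.j x ∉ P := fun h => Set.disjoint_left.1 hFP ⟨x, hx, rfl⟩ h
    have h1 := hgf (mem_image_of_mem D.j hx)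
    simp only [Function.comp, D.q_j] at h1
    rw [← h1]
    exact extendFrom_extends (f := g ∘ D.j)
      (hg.comp D.cont_j.continuousOn (fun y hy => hy)) x hx'

end Lower

/-! ### The concrete space `Z(X,Y)` -/

section Concrete

variable {X Y ι : Type} [TopologicalSpace X] [TopologicalSpace Y] [TopologicalSpace ι]

/-- The projection of `N` to the index space. -/
def zp : ZQuot ι X Y → OnePoint ι := Quot.lift (fun p => p.1) (fun _ _ h => h.1.trans h.2.1.symm)

/-- The projection of `N` to `X`. -/
def zq : ZQuot ι X Y → X := Quot.lift (fun p => p.2.1) (fun _ _ h => h.2.2)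

/-- The projection of the level `i` of `N` to `Y`. -/
def zr (i : ι) : ZQuot ι X Y → Y ⊕ Unit :=
  Quot.lift (fun p => if p.1 = (i : OnePoint ι) then Sum.inl p.2.2 else Sum.inr ()) (by
    intro a b h
    have ha : ¬ a.1 = (i : OnePoint ι) := by rw [h.1]; exact OnePoint.infty_ne_coe i
    have hb : ¬ b.1 = (i : OnePoint ι) := by rw [h.2.1]; exact OnePoint.infty_ne_coe i
    simp [ha, hb])

theorem continuous_zp : Continuous (zp (X := X) (Y := Y) (ι := ι)) :=
  continuous_quot_lift _ continuous_fst

theorem continuous_zq : Continuous (zq (X := X) (Y := Y) (ι := ι)) :=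
  continuous_quot_lift _ (by fun_prop)

variable [DiscreteTopology ι]

theorem continuous_zr (i : ι) : Continuous (zr (X := X) (Y := Y) i) := by
  refine continuous_quot_lift _ ?_
  have hcl : IsClopen {p : OnePoint ι × X × Y | p.1 = (i : OnePoint ι)} :=
    ⟨isClosed_singleton.preimage continuous_fst,
      (onePoint_isOpen_singleton i).preimage continuous_fst⟩
  refine Continuous.if ?_ (by fun_prop) (by fun_prop)
  intro a ha
  rw [hcl.frontier_eq] at ha
  exact absurd ha (Set.notMem_empty _)

theorem zquot_ext {z w : ZQuot ι X Y} (h1 : zp z = zp w) (h2 : zq z = zq w)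
    (h3 : ∀ i, zr i z = zr i w) : z = w := by
  induction z using Quot.ind with
  | mk a =>
  induction w using Quot.ind with
  | mk b =>
  obtain ⟨a, x, y⟩ := a
  obtain ⟨b, x', y'⟩ := b
  change a = b at h1
  change x = x' at h2
  subst h1 h2
  induction a using OnePoint.rec with
  | infty => exact Quot.sound ⟨rfl, rfl, rfl⟩
  | coe i =>
    have := h3 i
    simp only [zr, if_true, Sum.inl.injEq] at this
    rw [this]

theorem zquot_t2 [T2Space X] [T2Space Y] : T2Space (ZQuot ι X Y) := by
  refine T2Space.of_injective_continuous (Y := OnePoint ι × X × (ι → Y ⊕ Unit))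
    (f := fun z => (zp z, zq z, fun i => zr i z)) ?_ ?_
  · intro z w h
    simp only [Prod.mk.injEq] at h
    exact zquot_ext h.1 h.2.1 (fun i => congrFun h.2.2 i)
  · exact continuous_zp.prodMk (continuous_zq.prodMk (continuous_pi fun i => continuous_zr i))

theorem mem_zset {φ : ι → Set X} {z : ZQuot ι X Y} :
    z ∈ ZSet ι X Y φ ↔ ∀ i : ι, zp z = (i : OnePoint ι) → zq z ∈ φ i := by
  constructor
  · rintro ⟨p, rfl, h⟩ i hi
    change p.1 = _ at hi
    rcases h with h | ⟨i', h, h'⟩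
    · exact absurd (h.symm.trans hi) (OnePoint.infty_ne_coe i)
    · have : i' = i := OnePoint.coe_injective (h.symm.trans hi)
      subst this
      exact h'
  · intro h
    induction z using Quot.ind with
    | mk a =>
    refine ⟨a, rfl, ?_⟩
    obtain ⟨a, x, y⟩ := a
    induction a using OnePoint.rec with
    | infty => exact Or.inl rfl
    | coe i => exact Or.inr ⟨i, rfl, h i rfl⟩

theorem isClosed_zset {φ : ι → Set X} (hφ : ∀ i, IsClosed (φ i)) : IsClosed (ZSet ι X Y φ) := by
  have : ZSet ι X Y φ = ⋂ i : ι, ((zp ⁻¹' {(i : OnePoint ι)})ᶜ ∪ zq ⁻¹' (φ i)) := by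
    ext z
    simp only [mem_zset, mem_iInter, mem_union, mem_compl_iff, mem_preimage, mem_singleton_iff,
      imp_iff_not_or]
  rw [this]
  exact isClosed_iInter fun i => ((onePoint_isOpen_singleton i).preimage continuous_zp).isClosed_compl.union
    ((hφ i).preimage continuous_zq)

/-- The space `Z(X,Y)` has the required features. -/
def zdata [Nonempty Y] (φ : ι → Set X) : ZData (ZSpace ι X Y φ) X Y ι φ where
  p z := zp z.1
  q z := zq z.1
  j x := ⟨Quot.mk _ (OnePoint.infty, x, Classical.arbitrary Y), ⟨_, rfl, Or.inl rfl⟩⟩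
  k i s := ⟨Quot.mk _ ((i : OnePoint ι), s.1.1, s.2), ⟨_, rfl, Or.inr ⟨i, rfl, s.1.2⟩⟩⟩
  cont_p := continuous_zp.comp continuous_subtype_val
  cont_q := continuous_zq.comp continuous_subtype_val
  cont_j := (continuous_quot_mk.comp (by fun_prop)).subtype_mk _
  cont_k i := (continuous_quot_mk.comp (by fun_prop)).subtype_mk _
  k_inj i := by
    rintro ⟨⟨x, hx⟩, y⟩ ⟨⟨x', hx'⟩, y'⟩ h
    have h := congrArg Subtype.val h
    have h1 : x = x' := congrArg zq h
    have h2 := congrArg (zr i) h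
    simp only [zr, if_true, Sum.inl.injEq] at h2
    subst h1 h2
    rfl
  q_j x := rfl
  p_j x := rfl
  q_k i s := rfl
  p_k i s := rfl
  eq_j := by
    rintro ⟨z, hz⟩ h
    refine Subtype.ext ?_
    induction z using Quot.ind with
    | mk a =>
    exact Quot.sound ⟨h, rfl, rfl⟩
  eq_k := by
    rintro ⟨z, hz⟩ i h
    have hx := mem_zset.1 hz i h
    induction z using Quot.ind with
    | mk a =>
    obtain ⟨a, x, y⟩ := a
    change a = _ at h
    subst h
    exact ⟨(⟨x, hx⟩, y), rfl⟩

end Concrete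

/-! ### Dimension values -/

section Glue

theorem Dim.ofOrdinal_le {a b : Ordinal.{0}} : Dim.ofOrdinal a ≤ Dim.ofOrdinal b ↔ a ≤ b := by
  simp [Dim.ofOrdinal]

theorem Dim.ofOrdinal_lt {a b : Ordinal.{0}} : Dim.ofOrdinal a < Dim.ofOrdinal b ↔ a < b := by
  simp [Dim.ofOrdinal]

theorem lind_le {L X : Type} [TopologicalSpace L] [TopologicalSpace X] {α : Ordinal.{0}}
    (h : LIndLE L X α) : LInd L X ≤ Dim.ofOrdinal α := by
  unfold LInd
  split_ifs with h1 h2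
  · simp [Dim.minusOne, Dim.ofOrdinal]
  · exact Dim.ofOrdinal_le.2 (csInf_le' h)
  · exact absurd ⟨α, h⟩ h2

theorem lindLE_of_lind_eq {L X : Type} [TopologicalSpace L] [TopologicalSpace X] [Nonempty X]
    {α : Ordinal.{0}} (h : LInd L X = Dim.ofOrdinal α) : LIndLE L X α := by
  unfold LInd at h
  split_ifs at h with h1 h2
  · exact absurd h1 (not_isEmpty_of_nonempty X)
  · have h3 : sInf {α | LIndLE L X α} = α := by
      simpa [Dim.ofOrdinal] using h
    rw [← h3]
    exact csInf_mem (s := {α | LIndLE L X α}) h2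
  · exact absurd h.symm (by simp [Dim.ofOrdinal])

theorem lind_eq_top {L X : Type} [TopologicalSpace L] [TopologicalSpace X] [Nonempty X] :
    LInd L X = ⊤ ↔ ∀ α, ¬ LIndLE L X α := by
  unfold LInd
  rw [if_neg (not_isEmpty_of_nonempty X)]
  split_ifs with h2
  · simp only [Dim.ofOrdinal, WithTop.coe_ne_top, false_iff]
    push Not
    exact h2
  · push Not at h2
    simpa using h2

theorem lind_cases (L X : Type) [TopologicalSpace L] [TopologicalSpace X] [Nonempty X] :
    LInd L X = ⊤ ∨ ∃ α, LInd L X = Dim.ofOrdinal α := by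
  unfold LInd
  rw [if_neg (not_isEmpty_of_nonempty X)]
  split_ifs with h2
  · exact Or.inr ⟨_, rfl⟩
  · exact Or.inl rfl

theorem lind_eq {L X : Type} [TopologicalSpace L] [TopologicalSpace X] [Nonempty X]
    {α : Ordinal.{0}} (h : LIndLE L X (α + 1)) (h' : ¬ LIndLE L X α) :
    LInd L X = Dim.ofOrdinal α + 1 := by
  have e : Dim.ofOrdinal α + 1 = Dim.ofOrdinal (α + 1) := rfl
  rw [e]
  refine le_antisymm (lind_le h) ?_
  rcases lind_cases L X with h1 | ⟨β, h1⟩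
  · rw [h1]; exact le_top
  · rw [h1, Dim.ofOrdinal_le, ← not_lt, Order.lt_add_one_iff]
    exact fun h2 => h' (lindLE_mono_ord h2 (lindLE_of_lind_eq h1))

theorem not_lindLE_of_isEmpty {L : Type} [TopologicalSpace L] [IsEmpty L] (α : Ordinal.{0}) :
    ∀ (X : Type) [TopologicalSpace X] [Nonempty X], ¬ LIndLE L X α := by
  induction α using WellFoundedLT.induction with
  | ind α ih =>
  intro X _ _ h
  rw [lindLE_iff] at h
  obtain ⟨U, hU, hFU, ⟨g, -⟩, h3⟩ := h ∅ isClosed_empty ⟨fun x => x.2.elim, by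
    rw [continuous_iff_continuousAt]; exact fun x => x.2.elim⟩
  have hUe : U = ∅ := by
    rw [Set.eq_empty_iff_forall_notMem]
    exact fun x hx => isEmptyElim (g ⟨x, hx⟩)
  subst hUe
  rcases h3 with h3 | ⟨β, hβ, h3⟩
  · simp at h3
  · have : Nonempty ↥((∅ : Set X)ᶜ) := ⟨⟨Classical.arbitrary X, by simp⟩⟩
    exact ih β hβ _ h3

theorem aleph0_le_tWeight (X : Type) [TopologicalSpace X] [T2Space X] [Infinite X] :
    ℵ₀ ≤ tWeight X := by
  have hne : {c | ∃ B : Set (Set X), TopologicalSpace.IsTopologicalBasis B ∧ #B = c}.Nonempty :=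
    ⟨_, _, TopologicalSpace.isTopologicalBasis_opens, rfl⟩
  obtain ⟨B, hB, hBc⟩ := csInf_mem hne
  change #B = tWeight X at hBc
  rw [← hBc]
  by_contra hlt
  have hfin : Finite B := Cardinal.lt_aleph0_iff_finite.1 (not_le.1 hlt)
  have hinj : Function.Injective (fun x : X => {U : B | x ∈ U.1}) := by
    intro x y h
    by_contra hxy
    obtain ⟨V, hV, hxV, hVs⟩ := hB.exists_subset_of_mem_open (show x ∈ ({y} : Set X)ᶜ from hxy)
      isOpen_compl_singleton
    have : (⟨V, hV⟩ : B) ∈ {U : B | x ∈ U.1} := hxV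
    rw [show {U : B | x ∈ U.1} = {U : B | y ∈ U.1} from h] at this
    exact hVs this rfl
  exact not_finite_iff_infinite.2 ‹Infinite X› (Finite.of_injective _ hinj)

theorem lindPlus_le {L X : Type} [TopologicalSpace L] [TopologicalSpace X] {b : X} {U : Set X}
    (hU : IsOpen U) (hb : b ∈ U) {d : Dim} (hd : LInd L (closure U) ≤ d) : LIndPlus L b ≤ d :=
  csInf_le (OrderBot.bddBelow _) ⟨U, hU, hb, hd⟩

theorem lkset_not {L X : Type} [TopologicalSpace L] [TopologicalSpace X] {α : Ordinal.{0}}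
    (hX : LInd L X = Dim.ofOrdinal α) {b : X} (hb : b ∈ LKset L X) {U : Set X} (hU : IsOpen U)
    (hbU : b ∈ U) {β : Ordinal.{0}} (hβ : β < α) : ¬ LIndLE L (closure U) β := by
  intro h
  have h1 := lindPlus_le hU hbU (lind_le h)
  rw [show LIndPlus L b = LInd L X from hb, hX, Dim.ofOrdinal_le] at h1
  exact absurd hβ (not_lt.2 h1)

theorem lkset_closed {L X : Type} [TopologicalSpace L] [TopologicalSpace X] [Nonempty X]
    {α : Ordinal.{0}} (hX : LInd L X = Dim.ofOrdinal α) : IsClosed (LKset L X) := by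
  rw [← isOpen_compl_iff, isOpen_iff_forall_mem_open]
  intro b hb
  have hle : LIndPlus L b ≤ Dim.ofOrdinal α := by
    refine lindPlus_le isOpen_univ (mem_univ b) (lind_le ?_)
    rw [closure_univ]
    exact (lindLE_univ α).2 (lindLE_of_lind_eq hX)
  have hlt : LIndPlus L b < Dim.ofOrdinal α := lt_of_le_of_ne hle (by
    rw [← hX]; exact hb)
  obtain ⟨d, ⟨U, hU, hbU, hd⟩, hdα⟩ := exists_lt_of_csInf_lt
    (s := {d : Dim | ∃ U : Set X, IsOpen U ∧ b ∈ U ∧ LInd L (↥(closure U)) ≤ d})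
    ⟨⊤, Set.univ, isOpen_univ, mem_univ b, le_top⟩ hlt
  refine ⟨U, ?_, hU, hbU⟩
  intro c hc hcK
  have := lindPlus_le hU hc hd
  rw [show LIndPlus L c = LInd L X from hcK, hX] at this
  exact absurd hdα (not_lt.2 this)

end Glue

-- STATEMENT 12
theorem statement12 (L : Type) [MetricSpace L] [CompactSpace L]
    (hANR : IsANR L) (hL : ¬ContractibleSpace L)
    (X Y : Type) [TopologicalSpace X] [TopologicalSpace Y]
    [CompactSpace X] [CompactSpace Y] [T2Space X] [T2Space Y] [Nonempty X] [Nonempty Y]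
    [FrechetUrysohnSpace X]
    (ι : Type) [TopologicalSpace ι] [DiscreteTopology ι]
    (hι : ZCardOK X Y ι) (φ : ι → Set X) (hφ : ZPhiOK φ)
    (h1 : LInd L X = LInd L Y)
    (h2 : Dim.ofOrdinal 1 ≤ LInd L (↥(LKset L X))) :
    LInd L (ZSpace ι X Y φ) = LInd L X + 1 := by
  have hclosed : ∀ i, IsClosed (φ i) := fun i => (SFam.isCompact (hφ.1 i)).isClosed
  have hcompZ : CompactSpace (ZSpace ι X Y φ) :=
    isCompact_iff_compactSpace.1 (isClosed_zset hclosed).isCompact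
  have hT2 : T2Space (ZQuot ι X Y) := zquot_t2
  let D : ZData (ZSpace ι X Y φ) X Y ι φ := zdata φ
  have hneZ : Nonempty (ZSpace ι X Y φ) := ⟨D.j (Classical.arbitrary X)⟩
  rcases isEmpty_or_nonempty L with hLe | hLne
  · rw [lind_eq_top.2 fun α => not_lindLE_of_isEmpty α _,
      lind_eq_top.2 fun α => not_lindLE_of_isEmpty α _, WithTop.top_add]
  rcases lind_cases L X with hX | ⟨α, hX⟩
  · rw [hX, WithTop.top_add, lind_eq_top]
    intro α h
    refine lind_eq_top.1 hX α (lindLE_of_closedEmbedding α D.j ?_ h)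
    exact D.cont_j.isClosedEmbedding (Function.LeftInverse.injective D.q_j)
  obtain ⟨d⟩ := exists_anrData L hANR
  have hXα := lindLE_of_lind_eq hX
  have hYα := lindLE_of_lind_eq (h1 ▸ hX)
  rw [hX]
  refine lind_eq (D.upper d hφ.1 hXα hYα) ?_
  refine D.lower hφ ?_ (lkset_closed hX) ?_ ?_ ?_
  · intro hinf
    exact (aleph0_le_tWeight X).trans_lt hι.2.1
  · intro h
    have := h2.trans (lind_le h)
    rw [Dim.ofOrdinal_le] at this
    exact absurd this (by simp)
  · intro b hb U hU hbU β hβ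
    exact lkset_not hX hb hU hbU hβ
  · intro β hβ h
    have := lind_le h
    rw [← h1, hX, Dim.ofOrdinal_le] at this
    exact absurd hβ (not_lt.2 this)

end
end
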